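/- Assume that for every degree m ≤ n, every GC_m set possesses a maximal line (the GM conjecture up to degree n). Let X be a GC_n set with n ≥ 1 and n ≠ 3, and let ℓ be an n-node line of X. Then |X_ℓ| = binomial(n,2) or |X_ℓ| = binomial(n−1,2). -/

import Mathlib

open MvPolynomial

/-- Bivariate real polynomials. -/
abbrev Poly2 : Type := MvPolynomial (Fin 2) ℝ

/-- Evaluation of a bivariate polynomial at a point of `ℝ²`. -/
noncomputable def evalPt (p : Poly2) (A : ℝ × ℝ) : ℝ :=
  MvPolynomial.eval (fun i => if i = 0 then A.1 else A.2) p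

/-- `X` is an `n`-poised set: it has `(n+2 choose 2)` nodes and the only polynomial of
total degree at most `n` vanishing on all of `X` is the zero polynomial. -/
def IsPoised (n : ℕ) (X : Finset (ℝ × ℝ)) : Prop :=
  X.card = (n + 2).choose 2 ∧
    ∀ p : Poly2, p.totalDegree ≤ n → (∀ A ∈ X, evalPt p A = 0) → p = 0

/-- `p` is an `n`-fundamental polynomial of the node `A` with respect to `X`. -/
def IsFund (n : ℕ) (X : Finset (ℝ × ℝ)) (A : ℝ × ℝ) (p : Poly2) : Prop :=
  p.totalDegree ≤ n ∧ evalPt p A = 1 ∧ ∀ B ∈ X, B ≠ A → evalPt p B = 0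

/-- `X` is a `GC_n` set: `n`-poised and each node has a fundamental polynomial which is
a product of `n` polynomials of degree 1. -/
def IsGC (n : ℕ) (X : Finset (ℝ × ℝ)) : Prop :=
  IsPoised n X ∧
    ∀ A ∈ X, ∃ p : Poly2, IsFund n X A p ∧
      ∃ f : Fin n → Poly2, (∀ i, (f i).totalDegree = 1) ∧ p = ∏ i, f i

/-- The nodes of `X` lying on the zero set of `ℓ`. -/
noncomputable def nodesOn (X : Finset (ℝ × ℝ)) (ℓ : Poly2) : Finset (ℝ × ℝ) :=
  @Finset.filter _ (fun A => evalPt ℓ A = 0) (Classical.decPred _) X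

/-- `ℓ` is a `k`-node line of `X`: it has degree exactly 1 and passes through exactly
`k` nodes of `X`. -/
def IsKNodeLine (X : Finset (ℝ × ℝ)) (ℓ : Poly2) (k : ℕ) : Prop :=
  ℓ.totalDegree = 1 ∧ (nodesOn X ℓ).card = k

/-- A maximal line of an `n`-poised set: an `(n+1)`-node line. -/
def IsMaximalLine (n : ℕ) (X : Finset (ℝ × ℝ)) (ℓ : Poly2) : Prop :=
  IsKNodeLine X ℓ (n + 1)

/-- The zero set of a polynomial, i.e. the line it determines when it has degree 1. -/
def zeroSet (ℓ : Poly2) : Set (ℝ × ℝ) := {A | evalPt ℓ A = 0}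

/-- `μ(X)`: the number of maximal lines (as subsets of the plane) of `X`. -/
noncomputable def mu (n : ℕ) (X : Finset (ℝ × ℝ)) : ℕ :=
  {L : Set (ℝ × ℝ) | ∃ ℓ : Poly2, IsMaximalLine n X ℓ ∧ L = zeroSet ℓ}.ncard

/-- The node `A` of `X` uses the line `ℓ`: `ℓ` divides a fundamental polynomial of `A`. -/
def Uses (n : ℕ) (X : Finset (ℝ × ℝ)) (ℓ : Poly2) (A : ℝ × ℝ) : Prop :=
  ∃ p : Poly2, IsFund n X A p ∧ ℓ ∣ p

/-- `X_ℓ`: the set of nodes of `X` using the line `ℓ`. -/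
noncomputable def usesSet (n : ℕ) (X : Finset (ℝ × ℝ)) (ℓ : Poly2) : Finset (ℝ × ℝ) :=
  @Finset.filter _ (Uses n X ℓ) (Classical.decPred _) X

/-- The Gasca–Maeztu conjecture for degree `m`: every `GC_m` set has a maximal line. -/
def GM (m : ℕ) : Prop :=
  ∀ Y : Finset (ℝ × ℝ), IsGC m Y → ∃ lam : Poly2, IsMaximalLine m Y lam


namespace GCN

abbrev Pt := ℝ × ℝ

noncomputable def lin (a b c : ℝ) : Poly2 := C a * X 0 + C b * X 1 + C c

lemma evalPt_lin (a b c : ℝ) (A : Pt) : evalPt (lin a b c) A = a * A.1 + b * A.2 + c := by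
  simp [evalPt, lin]

lemma evalPt_mul (p q : Poly2) (A : Pt) : evalPt (p * q) A = evalPt p A * evalPt q A := by
  simp [evalPt]

lemma evalPt_sub (p q : Poly2) (A : Pt) : evalPt (p - q) A = evalPt p A - evalPt q A := by
  simp [evalPt]

lemma evalPt_C (r : ℝ) (A : Pt) : evalPt (C r) A = r := by
  simp [evalPt]

lemma evalPt_prod {ι : Type*} (s : Finset ι) (f : ι → Poly2) (A : Pt) :
    evalPt (∏ i ∈ s, f i) A = ∏ i ∈ s, evalPt (f i) A := by
  simp [evalPt, map_prod]

lemma lin_ne_zero {a b c : ℝ} (h : a ≠ 0 ∨ b ≠ 0) : lin a b c ≠ 0 := by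
  intro h0
  have h1 : ∀ A : Pt, a * A.1 + b * A.2 + c = 0 := by
    intro A
    rw [← evalPt_lin, h0]
    simp [evalPt]
  have e0 := h1 (0, 0)
  have e1 := h1 (1, 0)
  have e2 := h1 (0, 1)
  simp at e0 e1 e2
  rcases h with h | h <;> apply h <;> linarith

lemma totalDegree_lin_le (a b c : ℝ) : (lin a b c).totalDegree ≤ 1 := by
  unfold lin
  refine (totalDegree_add _ _).trans (max_le ((totalDegree_add _ _).trans (max_le ?_ ?_)) ?_)
  · refine (totalDegree_mul _ _).trans ?_
    simp
  · refine (totalDegree_mul _ _).trans ?_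
    simp
  · simp

lemma totalDegree_lin {a b c : ℝ} (h : a ≠ 0 ∨ b ≠ 0) : (lin a b c).totalDegree = 1 := by
  refine le_antisymm (totalDegree_lin_le a b c) ?_
  by_contra hlt
  have h0 : (lin a b c).totalDegree = 0 := by omega
  rw [totalDegree_eq_zero_iff_eq_C] at h0
  have h1 : ∀ A : Pt, a * A.1 + b * A.2 + c = coeff 0 (lin a b c) := by
    intro A
    rw [← evalPt_lin, h0, evalPt_C]
    simp
  have e0 := h1 (0, 0)
  have e1 := h1 (1, 0)
  have e2 := h1 (0, 1)
  simp at e0 e1 e2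
  rcases h with h | h <;> apply h <;> linarith

lemma exists_lin {p : Poly2} (hp : p.totalDegree = 1) :
    ∃ a b c : ℝ, (a ≠ 0 ∨ b ≠ 0) ∧ p = lin a b c := by
  have key : p = lin (coeff (Finsupp.single 0 1) p) (coeff (Finsupp.single 1 1) p)
      (coeff 0 p) := by
    ext m
    unfold lin
    simp only [coeff_add, coeff_C_mul, coeff_X, coeff_C]
    by_cases hm : m.degree ≤ 1
    · have hd : m.degree = m 0 + m 1 := by
        rw [Finsupp.degree_eq_sum]; simp
      have hm' : m = 0 ∨ m = Finsupp.single 0 1 ∨ m = Finsupp.single 1 1 := by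
        have h3 : (m 0 = 0 ∧ m 1 = 0) ∨ (m 0 = 1 ∧ m 1 = 0) ∨ (m 0 = 0 ∧ m 1 = 1) := by omega
        rcases h3 with ⟨h1, h2⟩ | ⟨h1, h2⟩ | ⟨h1, h2⟩
        · left; ext i; fin_cases i <;> simp [h1, h2]
        · right; left; ext i; fin_cases i <;> simp [h1, h2]
        · right; right; ext i; fin_cases i <;> simp [h1, h2]
      rcases hm' with h | h | h
      · subst h; simp
      · subst h; simp [Finsupp.single_eq_single_iff, eq_comm (a := (0 : Fin 2 →₀ ℕ))]
      · subst h; simp [Finsupp.single_eq_single_iff, eq_comm (a := (0 : Fin 2 →₀ ℕ))]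
    · have h0 : coeff m p = 0 := by
        apply coeff_eq_zero_of_totalDegree_lt
        rw [hp]
        have : m.degree = ∑ i ∈ m.support, m i := rfl
        omega
      have n0 : m ≠ 0 := by rintro rfl; simp at hm
      have n1 : Finsupp.single 0 1 ≠ m := by rintro rfl; simp at hm
      have n2 : Finsupp.single 1 1 ≠ m := by rintro rfl; simp at hm
      simp [h0, n0.symm, n1, n2]
  refine ⟨_, _, _, ?_, key⟩
  by_contra hab
  push Not at hab
  rw [hab.1, hab.2] at key
  rw [key] at hp
  simp [lin] at hp

lemma dvd_of_vanish {a b c : ℝ} (h : a ≠ 0 ∨ b ≠ 0) (p : Poly2)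
    (hv : ∀ A : Pt, a * A.1 + b * A.2 + c = 0 → evalPt p A = 0) : lin a b c ∣ p := by
  have gen : ∀ g : Fin 2 → Poly2, (∀ i, lin a b c ∣ X i - g i) →
      (∀ A : Pt, a * (evalPt (g 0) A) + b * (evalPt (g 1) A) + c = 0) → lin a b c ∣ p := by
    intro g hg hA
    have h1 : aeval g p = 0 := by
      apply MvPolynomial.funext
      intro x
      have h2 := hv (evalPt (g 0) (x 0, x 1), evalPt (g 1) (x 0, x 1)) (hA (x 0, x 1))
      have hx : (fun i : Fin 2 => if i = 0 then (x 0, x 1).1 else (x 0, x 1).2) = x := by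
        ext i; fin_cases i <;> simp
      rw [map_zero, ← h2]
      unfold evalPt
      rw [hx, ← MvPolynomial.coe_aeval_eq_eval, ← MvPolynomial.coe_aeval_eq_eval]
      show (aeval x) ((aeval g) p) = _
      rw [← AlgHom.comp_apply, MvPolynomial.comp_aeval]
      show _ = aeval _ p
      congr 2
      ext i; fin_cases i <;> simp
    have h3 : (Ideal.Quotient.mkₐ ℝ (Ideal.span {lin a b c})).comp (aeval g)
        = Ideal.Quotient.mkₐ ℝ (Ideal.span {lin a b c}) := by
      apply MvPolynomial.algHom_ext
      intro i
      simp only [AlgHom.comp_apply, aeval_X, Ideal.Quotient.mkₐ_eq_mk]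
      rw [Ideal.Quotient.eq, Ideal.mem_span_singleton]
      have := hg i
      rw [← dvd_neg]; simpa using this
    have h4 := DFunLike.congr_fun h3 p
    simp only [AlgHom.comp_apply, h1, map_zero] at h4
    rw [Ideal.Quotient.mkₐ_eq_mk, eq_comm, Ideal.Quotient.eq_zero_iff_mem,
      Ideal.mem_span_singleton] at h4
    exact h4
  rcases h with h | h
  · apply gen ![- C (a⁻¹ * b) * X 1 - C (a⁻¹ * c), X 1]
    · intro i
      fin_cases i
      · refine ⟨C a⁻¹, ?_⟩
        have e : (C a * C a⁻¹ : Poly2) = 1 := by rw [← C_mul, mul_inv_cancel₀ h, C_1]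
        simp [lin]
        linear_combination (-X 0) * e
      · simp
    · intro A
      simp [evalPt]
      field_simp
      ring
  · apply gen ![X 0, - C (b⁻¹ * a) * X 0 - C (b⁻¹ * c)]
    · intro i
      fin_cases i
      · simp
      · refine ⟨C b⁻¹, ?_⟩
        have e : (C b * C b⁻¹ : Poly2) = 1 := by rw [← C_mul, mul_inv_cancel₀ h, C_1]
        simp [lin]
        linear_combination (-X 1) * e
    · intro A
      simp [evalPt]
      field_simp
      ring

lemma vanish_of_card {a b c : ℝ} (h : a ≠ 0 ∨ b ≠ 0) (p : Poly2) (m : ℕ)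
    (hp : p.totalDegree ≤ m) (T : Finset Pt) (hT : ∀ A ∈ T, a * A.1 + b * A.2 + c = 0)
    (hT0 : ∀ A ∈ T, evalPt p A = 0) (hc : m < T.card) (B : Pt)
    (hB : a * B.1 + b * B.2 + c = 0) : evalPt p B = 0 := by
  have hs : 0 < a ^ 2 + b ^ 2 := by
    rcases h with h | h
    · have := sq_pos_of_ne_zero h; nlinarith [sq_nonneg b]
    · have := sq_pos_of_ne_zero h; nlinarith [sq_nonneg a]
  -- parametrize the line from B
  let g : Fin 2 → Polynomial ℝ :=
    ![Polynomial.C B.1 + Polynomial.C b * Polynomial.X,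
      Polynomial.C B.2 - Polynomial.C a * Polynomial.X]
  let r : Polynomial ℝ := aeval g p
  have hev : ∀ t : ℝ, r.eval t = evalPt p (B.1 + b * t, B.2 - a * t) := by
    intro t
    have : (Polynomial.aeval t) (aeval g p) =
        aeval (fun i => (Polynomial.aeval t) (g i)) p := by
      rw [← AlgHom.comp_apply, MvPolynomial.comp_aeval]
    rw [Polynomial.coe_aeval_eq_eval] at this
    show Polynomial.eval t (aeval g p) = _
    rw [this, evalPt, ← MvPolynomial.coe_aeval_eq_eval]
    show _ = aeval _ p
    congr 2
    ext i; fin_cases i <;> simp [g]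
  let τ : Pt → ℝ := fun A => ((A.1 - B.1) * b - (A.2 - B.2) * a) / (a ^ 2 + b ^ 2)
  have hτ : ∀ A : Pt, a * A.1 + b * A.2 + c = 0 →
      (B.1 + b * τ A, B.2 - a * τ A) = A := by
    intro A hA
    have e : a * (A.1 - B.1) + b * (A.2 - B.2) = 0 := by linarith
    apply Prod.ext
    · simp only [τ]
      field_simp
      linear_combination (-a) * e
    · simp only [τ]
      field_simp
      linear_combination (-b) * e
  have hr : r = 0 := by
    apply Polynomial.eq_zero_of_natDegree_lt_card_of_eval_eq_zero' r (T.image τ)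
    · intro t ht
      obtain ⟨A, hA, rfl⟩ := Finset.mem_image.1 ht
      rw [hev, hτ A (hT A hA)]
      exact hT0 A hA
    · rw [Finset.card_image_of_injOn]
      · refine lt_of_le_of_lt ?_ (lt_of_le_of_lt hp hc)
        have := MvPolynomial.aeval_natDegree_le p (m := p.totalDegree) (n := 1) le_rfl g (by
          intro i
          fin_cases i
          · simp only [g]
            refine (Polynomial.natDegree_add_le _ _).trans (max_le (by simp) ?_)
            exact (Polynomial.natDegree_C_mul_le _ _).trans (by simp)
          · simp only [g]
            refine (Polynomial.natDegree_sub_le _ _).trans (max_le (by simp) ?_)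
            exact (Polynomial.natDegree_C_mul_le _ _).trans (by simp))
        simpa using this
      · intro A hA A' hA' he
        have h1 := hτ A (hT A hA)
        have h2 := hτ A' (hT A' hA')
        rw [← h1, ← h2, he]
  have := hev 0
  rw [hr] at this
  simpa using this.symm

lemma exists_quot {a b c : ℝ} (h : a ≠ 0 ∨ b ≠ 0) (p : Poly2) (m : ℕ)
    (hp : p.totalDegree ≤ m) (T : Finset Pt) (hT : ∀ A ∈ T, a * A.1 + b * A.2 + c = 0)
    (hT0 : ∀ A ∈ T, evalPt p A = 0) (hc : m < T.card) :
    ∃ q : Poly2, p = lin a b c * q ∧ (q = 0 ∨ q.totalDegree + 1 ≤ m) := by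
  obtain ⟨q, hq⟩ := dvd_of_vanish (c := c) h p (vanish_of_card h p m hp T hT hT0 hc)
  refine ⟨q, hq, ?_⟩
  by_cases h0 : q = 0
  · exact Or.inl h0
  · right
    have := MvPolynomial.totalDegree_mul_of_isDomain (lin_ne_zero (c := c) h) h0
    rw [← hq, totalDegree_lin h] at this
    omega

def IsLine (l : Set Pt) : Prop :=
  ∃ a b c : ℝ, (a ≠ 0 ∨ b ≠ 0) ∧ l = {p : Pt | a * p.1 + b * p.2 + c = 0}

lemma IsLine.eq_of_two {l l' : Set Pt} (hl : IsLine l) (hl' : IsLine l') {A B : Pt}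
    (hAB : A ≠ B) (hA : A ∈ l) (hB : B ∈ l) (hA' : A ∈ l') (hB' : B ∈ l') : l = l' := by
  obtain ⟨a, b, c, h, rfl⟩ := hl
  obtain ⟨a', b', c', h', rfl⟩ := hl'
  simp only [Set.mem_ofPred_eq] at hA hB hA' hB'
  have hne : A.1 ≠ B.1 ∨ A.2 ≠ B.2 := by
    by_contra hc
    push Not at hc
    exact hAB (Prod.ext hc.1 hc.2)
  have e1 : a * (A.1 - B.1) + b * (A.2 - B.2) = 0 := by linarith
  have e2 : a' * (A.1 - B.1) + b' * (A.2 - B.2) = 0 := by linarith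
  have hdet : a * b' = a' * b := by
    rcases hne with hn | hn
    · have : A.1 - B.1 ≠ 0 := sub_ne_zero.2 hn
      apply mul_right_cancel₀ this
      linear_combination b' * e1 - b * e2
    · have : A.2 - B.2 ≠ 0 := sub_ne_zero.2 hn
      apply mul_right_cancel₀ this
      linear_combination (-a') * e1 + a * e2
  ext P
  simp only [Set.mem_ofPred_eq]
  have f1 : a * P.1 + b * P.2 + c = a * (P.1 - A.1) + b * (P.2 - A.2) := by linarith
  have f2 : a' * P.1 + b' * P.2 + c' = a' * (P.1 - A.1) + b' * (P.2 - A.2) := by linarith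
  rw [f1, f2]
  constructor
  · intro hP
    rcases h with h | h
    · apply mul_left_cancel₀ h
      linear_combination a' * hP + (P.2 - A.2) * hdet
    · apply mul_left_cancel₀ h
      linear_combination b' * hP - (P.1 - A.1) * hdet
  · intro hP
    rcases h' with h | h
    · apply mul_left_cancel₀ h
      linear_combination a * hP - (P.2 - A.2) * hdet
    · apply mul_left_cancel₀ h
      linear_combination b * hP + (P.1 - A.1) * hdet

open Classical in
noncomputable def lp (l : Set Pt) : Poly2 :=
  if h : IsLine l then lin h.choose h.choose_spec.choose h.choose_spec.choose_spec.choose else 1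

lemma lp_spec {l : Set Pt} (h : IsLine l) : ∃ a b c : ℝ, (a ≠ 0 ∨ b ≠ 0) ∧
    l = {p : Pt | a * p.1 + b * p.2 + c = 0} ∧ lp l = lin a b c := by
  refine ⟨h.choose, h.choose_spec.choose, h.choose_spec.choose_spec.choose,
    h.choose_spec.choose_spec.choose_spec.1, h.choose_spec.choose_spec.choose_spec.2, ?_⟩
  unfold lp
  rw [dif_pos h]

lemma lp_deg {l : Set Pt} (h : IsLine l) : (lp l).totalDegree = 1 := by
  obtain ⟨a, b, c, h1, h2, h3⟩ := lp_spec h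
  rw [h3, totalDegree_lin h1]

lemma lp_zero {l : Set Pt} (h : IsLine l) (A : Pt) : evalPt (lp l) A = 0 ↔ A ∈ l := by
  obtain ⟨a, b, c, h1, h2, h3⟩ := lp_spec h
  rw [h3, evalPt_lin, h2]
  rfl

lemma lp_ne {l : Set Pt} (h : IsLine l) : lp l ≠ 0 := by
  obtain ⟨a, b, c, h1, h2, h3⟩ := lp_spec h
  rw [h3]
  exact lin_ne_zero h1

lemma isLine_zeroSet {p : Poly2} (hp : p.totalDegree = 1) : IsLine (zeroSet p) := by
  obtain ⟨a, b, c, h, rfl⟩ := exists_lin hp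
  refine ⟨a, b, c, h, ?_⟩
  ext A
  simp [zeroSet, evalPt_lin]

lemma dvd_of_zeroSet {p q : Poly2} (hp : p.totalDegree = 1)
    (h : ∀ A ∈ zeroSet p, evalPt q A = 0) : p ∣ q := by
  obtain ⟨a, b, c, hab, rfl⟩ := exists_lin hp
  apply dvd_of_vanish hab
  intro A hA
  apply h
  simp [zeroSet, evalPt_lin, hA]

lemma line_quot {l : Set Pt} (hl : IsLine l) (p : Poly2) (m : ℕ)
    (hp : p.totalDegree ≤ m) (T : Finset Pt) (hT : ∀ A ∈ T, A ∈ l)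
    (hT0 : ∀ A ∈ T, evalPt p A = 0) (hc : m < T.card) :
    ∃ q : Poly2, p = lp l * q ∧ (q = 0 ∨ q.totalDegree + 1 ≤ m) := by
  obtain ⟨a, b, c, h1, h2, h3⟩ := lp_spec hl
  rw [h3]
  apply exists_quot h1 p m hp T _ hT0 hc
  intro A hA
  have := hT A hA
  rw [h2] at this
  exact this

/-- Every line carries arbitrarily many points. -/
lemma IsLine.infinite {l : Set Pt} (hl : IsLine l) : l.Infinite := by
  obtain ⟨a, b, c, h, rfl⟩ := hl
  rcases h with h | h
  · apply Set.infinite_of_injective_forall_mem (f := fun t : ℝ => ((-(b * t + c) / a, t) : Pt))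
    · intro s t hst
      simpa using congrArg Prod.snd hst
    · intro t
      simp only [Set.mem_ofPred_eq]
      field_simp
      ring
  · apply Set.infinite_of_injective_forall_mem (f := fun t : ℝ => ((t, -(a * t + c) / b) : Pt))
    · intro s t hst
      simpa using congrArg Prod.fst hst
    · intro t
      simp only [Set.mem_ofPred_eq]
      field_simp
      ring

lemma exists_line_not_mem (A : Pt) : ∃ l : Set Pt, IsLine l ∧ A ∉ l := by
  refine ⟨_, ⟨1, 0, 1 - A.1, Or.inl one_ne_zero, rfl⟩, ?_⟩
  simp

open Classical in
noncomputable def on (Y : Finset Pt) (l : Set Pt) : Finset Pt := Y.filter (· ∈ l)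

open Classical in
noncomputable def rm (Y : Finset Pt) (l : Set Pt) : Finset Pt := Y.filter (· ∉ l)

lemma mem_on {Y : Finset Pt} {l : Set Pt} {A : Pt} : A ∈ on Y l ↔ A ∈ Y ∧ A ∈ l := by
  simp [on]

lemma mem_rm {Y : Finset Pt} {l : Set Pt} {A : Pt} : A ∈ rm Y l ↔ A ∈ Y ∧ A ∉ l := by
  simp [rm]

lemma card_on_add_rm (Y : Finset Pt) (l : Set Pt) : (on Y l).card + (rm Y l).card = Y.card := by
  classical
  exact Finset.card_filter_add_card_filter_not _

/-- `F` is a set of at most `n` lines, avoiding `A`, covering the other nodes. -/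
def Cov (n : ℕ) (Y : Finset Pt) (A : Pt) (F : Finset (Set Pt)) : Prop :=
  F.card ≤ n ∧ (∀ l ∈ F, IsLine l) ∧ (∀ l ∈ F, A ∉ l) ∧ ∀ B ∈ Y, B ≠ A → ∃ l ∈ F, B ∈ l

def G (n : ℕ) (Y : Finset Pt) : Prop := IsPoised n Y ∧ ∀ A ∈ Y, ∃ F, Cov n Y A F

def Mx (n : ℕ) (Y : Finset Pt) (l : Set Pt) : Prop := IsLine l ∧ (on Y l).card = n + 1

def UsesC (n : ℕ) (Y : Finset Pt) (l : Set Pt) (A : Pt) : Prop := ∃ F, Cov n Y A F ∧ l ∈ F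

lemma G_of_IsGC {n : ℕ} {Y : Finset Pt} (h : IsGC n Y) : G n Y := by
  classical
  refine ⟨h.1, fun A hA => ?_⟩
  obtain ⟨p, ⟨-, hp1, hp2⟩, f, hf, rfl⟩ := h.2 A hA
  refine ⟨Finset.univ.image (fun i => zeroSet (f i)), ?_, ?_, ?_, ?_⟩
  · exact Finset.card_image_le.trans (by simp)
  · intro l hl
    obtain ⟨i, -, rfl⟩ := Finset.mem_image.1 hl
    exact isLine_zeroSet (hf i)
  · intro l hl hAl
    obtain ⟨i, -, rfl⟩ := Finset.mem_image.1 hl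
    rw [evalPt_prod, Finset.prod_eq_zero (Finset.mem_univ i) (show evalPt (f i) A = 0 from hAl)] at hp1
    exact zero_ne_one hp1
  · intro B hB hBA
    have := hp2 B hB hBA
    rw [evalPt_prod, Finset.prod_eq_zero_iff] at this
    obtain ⟨i, -, hi⟩ := this
    exact ⟨_, Finset.mem_image_of_mem _ (Finset.mem_univ i), hi⟩

lemma exists_fam {n : ℕ} {F : Finset (Set Pt)} (hF : F.card ≤ n) (l0 : Set Pt) :
    ∃ f : Fin n → Set Pt, (∀ i, f i ∈ F ∨ f i = l0) ∧ ∀ l ∈ F, ∃ i, f i = l := by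
  have : Nonempty (F ↪ Fin n) := by
    rw [Function.Embedding.nonempty_iff_card_le]
    simpa using hF
  obtain ⟨e⟩ := this
  refine ⟨Function.extend e (fun x => (x : Set Pt)) (fun _ => l0), ?_, ?_⟩
  · intro i
    by_cases hi : ∃ x, e x = i
    · obtain ⟨x, rfl⟩ := hi
      left
      rw [e.injective.extend_apply]
      exact x.2
    · right
      rw [Function.extend_apply' _ _ _ hi]
  · intro l hl
    exact ⟨e ⟨l, hl⟩, by rw [e.injective.extend_apply]⟩

/-- From a covering, get a fundamental polynomial as a product of lines. -/
lemma fund_of_cov {n : ℕ} {Y : Finset Pt} {A : Pt} {F : Finset (Set Pt)} (h : Cov n Y A F) :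
    ∃ f : Fin n → Poly2, (∀ i, (f i).totalDegree = 1) ∧ IsFund n Y A (∏ i, f i) ∧
      ∀ l ∈ F, ∃ i, ∀ B ∈ l, evalPt (f i) B = 0 := by
  obtain ⟨h1, h2, h3, h4⟩ := h
  obtain ⟨l0, hl0, hA0⟩ := exists_line_not_mem A
  obtain ⟨f, hf1, hf2⟩ := exists_fam h1 l0
  have hfl : ∀ i, IsLine (f i) := fun i => by
    rcases hf1 i with h | h
    · exact h2 _ h
    · rw [h]; exact hl0
  have hfA : ∀ i, evalPt (lp (f i)) A ≠ 0 := fun i => by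
    rw [Ne, lp_zero (hfl i)]
    rcases hf1 i with h | h
    · exact h3 _ h
    · rw [h]; exact hA0
  have hz : ∀ i, C (evalPt (lp (f i)) A)⁻¹ ≠ (0 : Poly2) := fun i => by
    rw [Ne, C_eq_zero]
    exact inv_ne_zero (hfA i)
  have hdeg : ∀ i, (C (evalPt (lp (f i)) A)⁻¹ * lp (f i)).totalDegree = 1 := fun i => by
    rw [totalDegree_mul_of_isDomain (hz i) (lp_ne (hfl i)), lp_deg (hfl i)]
    simp
  refine ⟨fun i => C (evalPt (lp (f i)) A)⁻¹ * lp (f i), hdeg, ⟨?_, ?_, ?_⟩, ?_⟩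
  · refine (totalDegree_finsetProd _ _).trans ?_
    rw [Finset.sum_congr rfl (fun i _ => hdeg i)]
    simp
  · rw [evalPt_prod]
    apply Finset.prod_eq_one
    intro i _
    rw [evalPt_mul, evalPt_C, inv_mul_cancel₀ (hfA i)]
  · intro B hB hBA
    obtain ⟨l, hl, hBl⟩ := h4 B hB hBA
    obtain ⟨i, rfl⟩ := hf2 l hl
    rw [evalPt_prod]
    apply Finset.prod_eq_zero (Finset.mem_univ i)
    rw [evalPt_mul, (lp_zero (hfl i) B).2 hBl, mul_zero]
  · intro l hl
    obtain ⟨i, rfl⟩ := hf2 l hl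
    refine ⟨i, fun B hB => ?_⟩
    rw [evalPt_mul, (lp_zero (hfl i) B).2 hB, mul_zero]

lemma IsGC_of_G {n : ℕ} {Y : Finset Pt} (h : G n Y) : IsGC n Y := by
  refine ⟨h.1, fun A hA => ?_⟩
  obtain ⟨F, hF⟩ := h.2 A hA
  obtain ⟨f, h1, h2, -⟩ := fund_of_cov hF
  exact ⟨_, h2, f, h1, rfl⟩

lemma nodesOn_eq (Y : Finset Pt) (p : Poly2) : nodesOn Y p = on Y (zeroSet p) := by
  ext A
  exact (@Finset.mem_filter _ _ (Classical.decPred _) _ _).trans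
    (mem_on (Y := Y) (l := zeroSet p) (A := A)).symm

/-- The GM hypothesis in terms of lines as sets. -/
def GMC (n : ℕ) : Prop := ∀ m ≤ n, ∀ Y, G m Y → ∃ M, Mx m Y M

lemma GMC_of {n : ℕ} (h : ∀ m ≤ n, GM m) : GMC n := by
  intro m hm Y hY
  obtain ⟨lam, h1, h2⟩ := h m hm Y (IsGC_of_G hY)
  exact ⟨zeroSet lam, isLine_zeroSet h1, by rw [← nodesOn_eq]; exact h2⟩

lemma fund_unique {n : ℕ} {Y : Finset Pt} (h : IsPoised n Y) {A : Pt} {p q : Poly2}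
    (hp : IsFund n Y A p) (hq : IsFund n Y A q) : p = q := by
  rw [← sub_eq_zero]
  apply h.2
  · exact (totalDegree_sub _ _).trans (max_le hp.1 hq.1)
  · intro B hB
    rw [evalPt_sub]
    by_cases hBA : B = A
    · rw [hBA, hp.2.1, hq.2.1, sub_self]
    · rw [hp.2.2 B hB hBA, hq.2.2 B hB hBA, sub_self]

/-- Pigeonhole on a line. -/
lemma pigeon {F : Finset (Set Pt)} {K : Set Pt} {T : Finset Pt} (hF : ∀ l ∈ F, IsLine l)
    (hK : IsLine K) (hKF : K ∉ F) (hT : ∀ A ∈ T, A ∈ K) (hc : ∀ A ∈ T, ∃ l ∈ F, A ∈ l) :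
    T.card ≤ F.card := by
  classical
  choose! g hg1 hg2 using hc
  apply Finset.card_le_card_of_injOn g
  · intro A hA; exact hg1 A hA
  · intro A hA B hB hAB
    by_contra hne
    apply hKF
    have : K = g A := hK.eq_of_two (hF _ (hg1 A hA)) hne (hT A hA) (hT B hB) (hg2 A hA)
      (by rw [hAB]; exact hg2 B hB)
    rw [this]
    exact hg1 A hA

lemma uses_iff {n : ℕ} {Y : Finset Pt} (h : G n Y) {p : Poly2} (hp : p.totalDegree = 1) {A : Pt}
    (hA : A ∈ Y) : Uses n Y p A ↔ UsesC n Y (zeroSet p) A := by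
  constructor
  · rintro ⟨r, hr, hpr⟩
    obtain ⟨F, hF⟩ := h.2 A hA
    have hF' := hF
    obtain ⟨h1, h2, h3, h4⟩ := hF
    refine ⟨F, hF', ?_⟩
    by_contra hnot
    -- polynomial of the covering
    have hcard : (F.prod lp).totalDegree ≤ n := by
      refine (totalDegree_finsetProd _ _).trans ?_
      rw [Finset.sum_congr rfl (fun l hl => lp_deg (h2 l hl))]
      simpa using h1
    have hA0 : evalPt (F.prod lp) A ≠ 0 := by
      rw [evalPt_prod, Finset.prod_ne_zero_iff]
      intro l hl
      rw [Ne, lp_zero (h2 l hl)]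
      exact h3 l hl
    have hfund : IsFund n Y A (C (evalPt (F.prod lp) A)⁻¹ * F.prod lp) := by
      refine ⟨?_, ?_, ?_⟩
      · refine (totalDegree_mul _ _).trans ?_
        simpa using hcard
      · rw [evalPt_mul, evalPt_C, inv_mul_cancel₀ hA0]
      · intro B hB hBA
        obtain ⟨l, hl, hBl⟩ := h4 B hB hBA
        have e0 : evalPt (F.prod lp) B = 0 := by
          rw [evalPt_prod]
          exact Finset.prod_eq_zero hl ((lp_zero (h2 l hl) B).2 hBl)
        rw [evalPt_mul, e0, mul_zero]
    have hre := fund_unique h.1 hr hfund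
    have hcov : ∀ B ∈ zeroSet p, ∃ l ∈ F, B ∈ l := by
      intro B hB
      obtain ⟨q, hq⟩ := hpr
      have e : evalPt r B = 0 := by
        rw [hq, evalPt_mul, show evalPt p B = 0 from hB, zero_mul]
      rw [hre, evalPt_mul, evalPt_C, mul_eq_zero, or_iff_right (inv_ne_zero hA0), evalPt_prod,
        Finset.prod_eq_zero_iff] at e
      obtain ⟨l, hl, hl0⟩ := e
      exact ⟨l, hl, (lp_zero (h2 l hl) B).1 hl0⟩
    obtain ⟨T, hT1, hT2⟩ := (isLine_zeroSet hp).infinite.exists_subset_card_eq (F.card + 1)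
    have := pigeon h2 (isLine_zeroSet hp) hnot (T := T) (fun A hA => hT1 hA)
      (fun A hA => hcov A (hT1 hA))
    omega
  · rintro ⟨F, hF, hpF⟩
    obtain ⟨f, h1, h2, h3⟩ := fund_of_cov hF
    refine ⟨_, h2, ?_⟩
    obtain ⟨i, hi⟩ := h3 _ hpF
    exact (dvd_of_zeroSet hp hi).trans
      (Finset.dvd_prod_of_mem _ (Finset.mem_univ i))

lemma card_usesSet {n : ℕ} {Y : Finset Pt} (h : G n Y) {p : Poly2} (hp : p.totalDegree = 1)
    (S : Finset Pt) (hS : ∀ A, A ∈ S ↔ A ∈ Y ∧ UsesC n Y (zeroSet p) A) :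
    (usesSet n Y p).card = S.card := by
  congr 1
  ext A
  rw [hS, usesSet, @Finset.mem_filter _ _ (Classical.decPred _)]
  constructor
  · rintro ⟨h1, h2⟩
    exact ⟨h1, (uses_iff h hp h1).1 h2⟩
  · rintro ⟨h1, h2⟩
    exact ⟨h1, (uses_iff h hp h1).2 h2⟩

lemma Cov.notin {n : ℕ} {Y : Finset Pt} {A : Pt} {F : Finset (Set Pt)} (h : Cov n Y A F)
    {l : Set Pt} (hA : A ∈ l) : l ∉ F := fun hl => h.2.2.1 l hl hA

lemma card_le {n : ℕ} {Y : Finset Pt} (h : G n Y) {l : Set Pt} (hl : IsLine l) :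
    (on Y l).card ≤ n + 1 := by
  classical
  rcases (on Y l).eq_empty_or_nonempty with h0 | ⟨A, hA⟩
  · simp [h0]
  · obtain ⟨F, hF⟩ := h.2 A (mem_on.1 hA).1
    have := pigeon hF.2.1 hl (hF.notin (mem_on.1 hA).2) (T := (on Y l).erase A)
      (fun B hB => (mem_on.1 (Finset.mem_of_mem_erase hB)).2)
      (fun B hB => hF.2.2.2 B (mem_on.1 (Finset.mem_of_mem_erase hB)).1
        (Finset.ne_of_mem_erase hB))
    rw [Finset.card_erase_of_mem hA] at this
    have := hF.1
    omega

lemma mx_mem {n : ℕ} {Y : Finset Pt} {M : Set Pt} (hM : Mx n Y M) {A : Pt}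
    {F : Finset (Set Pt)} (hF : Cov n Y A F) (hA : A ∉ M) : M ∈ F := by
  by_contra hn
  have := pigeon hF.2.1 hM.1 hn (T := on Y M) (fun B hB => (mem_on.1 hB).2)
    (fun B hB => hF.2.2.2 B (mem_on.1 hB).1 (by
      rintro rfl; exact hA (mem_on.1 hB).2))
  have h1 := hF.1
  have h2 := hM.2
  omega

lemma cov_erase [DecidableEq (Set Pt)] {n : ℕ} {Y : Finset Pt} {M : Set Pt} {A : Pt}
    {F : Finset (Set Pt)} (hF : Cov (n + 1) Y A F) (hM : M ∈ F) :
    Cov n (rm Y M) A (F.erase M) := by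
  refine ⟨?_, ?_, ?_, ?_⟩
  · rw [Finset.card_erase_of_mem hM]
    have := hF.1
    omega
  · exact fun l hl => hF.2.1 l (Finset.mem_of_mem_erase hl)
  · exact fun l hl => hF.2.2.1 l (Finset.mem_of_mem_erase hl)
  · intro B hB hBA
    obtain ⟨l, hl, hBl⟩ := hF.2.2.2 B (mem_rm.1 hB).1 hBA
    refine ⟨l, Finset.mem_erase.2 ⟨?_, hl⟩, hBl⟩
    rintro rfl
    exact (mem_rm.1 hB).2 hBl

lemma cov_insert [DecidableEq (Set Pt)] {n : ℕ} {Y : Finset Pt} {M : Set Pt} {A : Pt}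
    {F : Finset (Set Pt)} (hF : Cov n (rm Y M) A F) (hM : IsLine M) (hA : A ∉ M) :
    Cov (n + 1) Y A (insert M F) := by
  refine ⟨?_, ?_, ?_, ?_⟩
  · have := hF.1
    exact (Finset.card_insert_le _ _).trans (by omega)
  · intro l hl
    rcases Finset.mem_insert.1 hl with rfl | hl
    · exact hM
    · exact hF.2.1 l hl
  · intro l hl
    rcases Finset.mem_insert.1 hl with rfl | hl
    · exact hA
    · exact hF.2.2.1 l hl
  · intro B hB hBA
    by_cases hBM : B ∈ M
    · exact ⟨M, Finset.mem_insert_self _ _, hBM⟩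
    · obtain ⟨l, hl, hBl⟩ := hF.2.2.2 B (mem_rm.2 ⟨hB, hBM⟩) hBA
      exact ⟨l, Finset.mem_insert_of_mem hl, hBl⟩

lemma G_rm {n : ℕ} {Y : Finset Pt} {M : Set Pt} (h : G (n + 1) Y) (hM : Mx (n + 1) Y M) :
    G n (rm Y M) := by
  classical
  refine ⟨⟨?_, ?_⟩, ?_⟩
  · have h1 := card_on_add_rm Y M
    rw [hM.2, h.1.1] at h1
    have h2 : (n + 1 + 2).choose 2 = (n + 2).choose 1 + (n + 2).choose 2 :=
      Nat.choose_succ_succ _ _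
    rw [Nat.choose_one_right] at h2
    omega
  · intro p hp hv
    have : lp M * p = 0 := by
      apply h.1.2
      · refine (totalDegree_mul _ _).trans ?_
        rw [lp_deg hM.1]
        omega
      · intro A hA
        rw [evalPt_mul]
        by_cases hAM : A ∈ M
        · rw [(lp_zero hM.1 A).2 hAM, zero_mul]
        · rw [hv A (mem_rm.2 ⟨hA, hAM⟩), mul_zero]
    exact (mul_eq_zero.1 this).resolve_left (lp_ne hM.1)
  · intro A hA
    obtain ⟨hA1, hA2⟩ := mem_rm.1 hA
    obtain ⟨F, hF⟩ := h.2 A hA1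
    exact ⟨_, cov_erase hF (mx_mem hM hF hA2)⟩

lemma on_rm_card {Y : Finset Pt} {M l : Set Pt} (hM : IsLine M) (hl : IsLine l) (hne : M ≠ l)
    {P : Pt} (hP : P ∈ Y) (hPM : P ∈ M) (hPl : P ∈ l) :
    (on (rm Y M) l).card + 1 = (on Y l).card := by
  classical
  have : on (rm Y M) l = (on Y l).erase P := by
    ext Q
    simp only [mem_on, mem_rm, Finset.mem_erase]
    constructor
    · rintro ⟨⟨h1, h2⟩, h3⟩
      exact ⟨by rintro rfl; exact h2 hPM, h1, h3⟩
    · rintro ⟨h1, h2, h3⟩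
      exact ⟨⟨h2, fun h4 => hne (hM.eq_of_two hl h1 h4 hPM h3 hPl)⟩, h3⟩
  rw [this, Finset.card_erase_of_mem (mem_on.2 ⟨hP, hPl⟩)]
  have : 0 < (on Y l).card := Finset.card_pos.2 ⟨P, mem_on.2 ⟨hP, hPl⟩⟩
  omega

lemma on_rm_miss {Y : Finset Pt} {M l : Set Pt} (h : ∀ P ∈ Y, P ∈ M → P ∉ l) :
    on (rm Y M) l = on Y l := by
  ext Q
  simp only [mem_on, mem_rm]
  constructor
  · rintro ⟨⟨h1, h2⟩, h3⟩
    exact ⟨h1, h3⟩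
  · rintro ⟨h1, h3⟩
    exact ⟨⟨h1, fun h4 => h Q h1 h4 h3⟩, h3⟩

lemma Mx.exists_node {n : ℕ} {Y : Finset Pt} {M : Set Pt} (h : Mx n Y M) :
    ∃ P ∈ Y, P ∈ M := by
  have : 0 < (on Y M).card := by rw [h.2]; omega
  obtain ⟨P, hP⟩ := Finset.card_pos.1 this
  exact ⟨P, mem_on.1 hP⟩

lemma mx_common {n : ℕ} {Y : Finset Pt} (h : G n Y) {M M' : Set Pt} (hM : Mx n Y M)
    (hM' : Mx n Y M') : ∃ P ∈ Y, P ∈ M ∧ P ∈ M' := by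
  cases n with
  | zero =>
    obtain ⟨P, hP, hPM⟩ := hM.exists_node
    obtain ⟨Q, hQ, hQM⟩ := hM'.exists_node
    have h1 : Y.card ≤ 1 := by rw [h.1.1]; decide
    have := Finset.card_le_one.1 h1 P hP Q hQ
    subst this
    exact ⟨P, hP, hPM, hQM⟩
  | succ n =>
    by_contra hc
    push Not at hc
    have h1 := card_le (G_rm h hM) hM'.1
    rw [on_rm_miss hc, hM'.2] at h1
    omega

lemma mx_rm {n : ℕ} {Y : Finset Pt} (h : G (n + 1) Y) {M M' : Set Pt} (hM : Mx (n + 1) Y M)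
    (hM' : Mx (n + 1) Y M') (hne : M ≠ M') : Mx n (rm Y M) M' := by
  obtain ⟨P, hP, h1, h2⟩ := mx_common h hM hM'
  refine ⟨hM'.1, ?_⟩
  have := on_rm_card hM.1 hM'.1 hne hP h1 h2
  rw [hM'.2] at this
  omega

lemma no3 {n : ℕ} {Y : Finset Pt} (h : G (n + 1) Y) {M1 M2 M3 : Set Pt}
    (h1 : Mx (n + 1) Y M1) (h2 : Mx (n + 1) Y M2) (h3 : Mx (n + 1) Y M3)
    (h12 : M1 ≠ M2) (h13 : M1 ≠ M3) (h23 : M2 ≠ M3) {P : Pt} (p1 : P ∈ M1) (p2 : P ∈ M2)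
    (p3 : P ∈ M3) : False := by
  obtain ⟨Q, hQ, q2, q3⟩ := mx_common (G_rm h h1) (mx_rm h h1 h2 h12) (mx_rm h h1 h3 h13)
  have hne : P ≠ Q := by
    rintro rfl
    exact (mem_rm.1 hQ).2 p1
  exact h23 (h2.1.eq_of_two h3.1 hne p2 q2 p3 q3)

lemma mx_rm_ne {n : ℕ} {Y : Finset Pt} {L K : Set Pt} (hK : Mx n (rm Y L) K) : L ≠ K := by
  rintro rfl
  obtain ⟨P, hP, h1⟩ := hK.exists_node
  exact (mem_rm.1 hP).2 h1

lemma mx_of_hit {n : ℕ} {Y : Finset Pt} {L K : Set Pt} (hL : IsLine L)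
    (hK : Mx n (rm Y L) K) {P : Pt} (hP : P ∈ Y) (hPL : P ∈ L) (hPK : P ∈ K) :
    Mx (n + 1) Y K := by
  refine ⟨hK.1, ?_⟩
  rw [← on_rm_card hL hK.1 (mx_rm_ne hK) hP hPL hPK, hK.2]

/-- `K` and `L` share no node. -/
def Miss (Y : Finset Pt) (L K : Set Pt) : Prop := ∀ P ∈ Y, P ∈ L → P ∉ K

lemma miss_notin {n : ℕ} {Y : Finset Pt} {L K : Set Pt} (hL : Mx (n + 1) Y L)
    (hm : Miss Y L K) {A : Pt} (hA : A ∈ Y) (hAL : A ∈ L) {F : Finset (Set Pt)}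
    (hF : Cov (n + 1) Y A F) : K ∉ F := by
  classical
  intro hK
  have hF' := cov_erase hF hK
  have := pigeon hF'.2.1 hL.1 (hF'.notin hAL) (T := (on Y L).erase A)
    (fun B hB => (mem_on.1 (Finset.mem_of_mem_erase hB)).2)
    (fun B hB => by
      have hB' := mem_on.1 (Finset.mem_of_mem_erase hB)
      exact hF'.2.2.2 B (mem_rm.2 ⟨hB'.1, hm B hB'.1 hB'.2⟩) (Finset.ne_of_mem_erase hB))
  rw [Finset.card_erase_of_mem (mem_on.2 ⟨hA, hAL⟩), hL.2] at this
  have := hF'.1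
  omega

lemma exact_hit {m : ℕ} {F : Finset (Set Pt)} {K : Set Pt} {T : Finset Pt}
    (hF : ∀ l ∈ F, IsLine l) (hK : IsLine K) (hKF : K ∉ F) (hT : ∀ A ∈ T, A ∈ K)
    (hc : ∀ A ∈ T, ∃ l ∈ F, A ∈ l) (hFm : F.card ≤ m) (hTm : m ≤ T.card) {l : Set Pt}
    (hl : l ∈ F) : ∃ P ∈ T, P ∈ l := by
  classical
  by_contra hn
  push Not at hn
  have := pigeon (F := F.erase l) (fun l' hl' => hF l' (Finset.mem_of_mem_erase hl')) hK
    (fun h => hKF (Finset.mem_of_mem_erase h)) hT (by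
      intro A hA
      obtain ⟨l', h1, h2⟩ := hc A hA
      exact ⟨l', Finset.mem_erase.2 ⟨by rintro rfl; exact hn A hA h2, h1⟩, h2⟩)
  rw [Finset.card_erase_of_mem hl] at this
  have := Finset.card_pos.2 ⟨l, hl⟩
  omega

lemma exact_unique {m : ℕ} {F : Finset (Set Pt)} {K : Set Pt} {T : Finset Pt}
    (hF : ∀ l ∈ F, IsLine l) (hK : IsLine K) (hKF : K ∉ F) (hT : ∀ A ∈ T, A ∈ K)
    (hc : ∀ A ∈ T, ∃ l ∈ F, A ∈ l) (hFm : F.card ≤ m) (hTm : m ≤ T.card) {l l' : Set Pt}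
    (hl : l ∈ F) (hl' : l' ∈ F) {P : Pt} (hP : P ∈ T) (hPl : P ∈ l) (hPl' : P ∈ l') :
    l = l' := by
  classical
  by_contra hn
  have := pigeon (F := F.erase l) (fun l' hl' => hF l' (Finset.mem_of_mem_erase hl')) hK
    (fun h => hKF (Finset.mem_of_mem_erase h)) hT (by
      intro A hA
      by_cases hAP : A = P
      · subst hAP
        exact ⟨l', Finset.mem_erase.2 ⟨fun h => hn h.symm, hl'⟩, hPl'⟩
      obtain ⟨l2, h1, h2⟩ := hc A hA
      refine ⟨l2, Finset.mem_erase.2 ⟨?_, h1⟩, h2⟩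
      rintro rfl
      exact hKF ((hK.eq_of_two (hF _ hl) hAP (hT A hA) (hT P hP) h2 hPl) ▸ hl))
  rw [Finset.card_erase_of_mem hl] at this
  have := Finset.card_pos.2 ⟨l, hl⟩
  omega

/-- The product of the lines in `F`. -/
noncomputable def pr (F : Finset (Set Pt)) : Poly2 := ∏ l ∈ F, lp l

lemma pr_deg {F : Finset (Set Pt)} (hF : ∀ l ∈ F, IsLine l) : (pr F).totalDegree ≤ F.card := by
  unfold pr
  refine (totalDegree_finsetProd _ _).trans ?_
  rw [Finset.sum_congr rfl (fun l hl => lp_deg (hF l hl))]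
  simp

lemma pr_zero {F : Finset (Set Pt)} (hF : ∀ l ∈ F, IsLine l) {P : Pt} {l : Set Pt} (hl : l ∈ F)
    (hP : P ∈ l) : evalPt (pr F) P = 0 := by
  unfold pr
  rw [evalPt_prod]
  exact Finset.prod_eq_zero hl ((lp_zero (hF l hl) P).2 hP)

lemma pr_ne {F : Finset (Set Pt)} (hF : ∀ l ∈ F, IsLine l) {P : Pt} (h : ∀ l ∈ F, P ∉ l) :
    evalPt (pr F) P ≠ 0 := by
  unfold pr
  rw [evalPt_prod, Finset.prod_ne_zero_iff]
  intro l hl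
  rw [Ne, lp_zero (hF l hl)]
  exact h l hl

/-- Key algebraic lemma: the lines through `O` used by different nodes of `L` are different. -/
lemma key_inj {n : ℕ} {Y : Finset Pt} {L K1 K2 : Set Pt} (hL : Mx (n + 2) Y L)
    (h1 : Mx (n + 1) (rm Y L) K1) (h2 : Mx (n + 1) (rm Y L) K2) (h12 : K1 ≠ K2)
    (m1 : Miss Y L K1) (m2 : Miss Y L K2) {O : Pt} (hO : O ∈ rm Y L) (hO1 : O ∈ K1)
    (hO2 : O ∈ K2) {A A' : Pt} (hA : A ∈ Y) (hAL : A ∈ L) (hA' : A' ∈ Y) (hAL' : A' ∈ L)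
    (hne : A ≠ A') {F F' : Finset (Set Pt)} (hF : Cov (n + 2) Y A F)
    (hF' : Cov (n + 2) Y A' F') {r : Set Pt} (hr : r ∈ F) (hr' : r ∈ F') (hOr : O ∈ r) :
    False := by
  classical
  have aux : ∀ (A : Pt) (F : Finset (Set Pt)), A ∈ Y → A ∈ L → Cov (n + 2) Y A F → r ∈ F →
      (∀ l ∈ F.erase r, IsLine l) ∧ (F.erase r).card ≤ n + 1 ∧
      evalPt (pr (F.erase r)) O ≠ 0 ∧
      (∀ P ∈ rm Y L, P ≠ O → P ∈ K1 → evalPt (pr (F.erase r)) P = 0) ∧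
      (∀ P ∈ rm Y L, P ≠ O → P ∈ K2 → evalPt (pr (F.erase r)) P = 0) ∧
      (∀ P ∈ Y, P ≠ A → P ∉ r → evalPt (pr (F.erase r)) P = 0) ∧
      evalPt (pr (F.erase r)) A ≠ 0 := by
    intro A F hA hAL hF hr
    have hlines : ∀ l ∈ F.erase r, IsLine l := fun l hl => hF.2.1 l (Finset.mem_of_mem_erase hl)
    have hn1 := miss_notin hL m1 hA hAL hF
    have hn2 := miss_notin hL m2 hA hAL hF
    have hP0 : ∀ P ∈ Y, P ≠ A → P ∉ r → evalPt (pr (F.erase r)) P = 0 := by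
      intro P hP hPA hPr
      obtain ⟨l, hl, hPl⟩ := hF.2.2.2 P hP hPA
      exact pr_zero hlines (Finset.mem_erase.2 ⟨by rintro rfl; exact hPr hPl, hl⟩) hPl
    have hK : ∀ K, Mx (n + 1) (rm Y L) K → O ∈ K → K ∉ F →
        ∀ P ∈ rm Y L, P ≠ O → P ∈ K → evalPt (pr (F.erase r)) P = 0 := by
      intro K hK hOK hKF P hP hPO hPK
      refine hP0 P (mem_rm.1 hP).1 ?_ ?_
      · rintro rfl
        exact (mem_rm.1 hP).2 hAL
      · intro hPr
        exact hKF ((hK.1.eq_of_two (hF.2.1 r hr) hPO hPK hOK hPr hOr) ▸ hr)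
    refine ⟨hlines, ?_, ?_, hK K1 h1 hO1 hn1, hK K2 h2 hO2 hn2, hP0, ?_⟩
    · rw [Finset.card_erase_of_mem hr]
      have := hF.1
      omega
    · apply pr_ne hlines
      intro l hl hOl
      apply Finset.ne_of_mem_erase hl
      refine exact_unique hF.2.1 h1.1 hn1 (T := on (rm Y L) K1) (m := n + 2)
        (fun B hB => (mem_on.1 hB).2) ?_ hF.1 (by rw [h1.2]) (Finset.mem_of_mem_erase hl) hr
        (mem_on.2 ⟨hO, hO1⟩) hOl hOr
      intro B hB
      obtain ⟨hB1, hB2⟩ := mem_rm.1 (mem_on.1 hB).1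
      exact hF.2.2.2 B hB1 (by rintro rfl; exact hB2 hAL)
    · apply pr_ne hlines
      exact fun l hl => hF.2.2.1 l (Finset.mem_of_mem_erase hl)
  obtain ⟨a1, a2, a3, a4, a5, a6, a7⟩ := aux A F hA hAL hF hr
  obtain ⟨b1, b2, b3, b4, b5, b6, b7⟩ := aux A' F' hA' hAL' hF' hr'
  set q := pr (F.erase r) with hq
  set q' := pr (F'.erase r) with hq'
  let g : Poly2 := C (evalPt q' O) * q - C (evalPt q O) * q'
  have gev : ∀ P, evalPt g P = evalPt q' O * evalPt q P - evalPt q O * evalPt q' P := by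
    intro P
    simp only [g, evalPt_sub, evalPt_mul, evalPt_C]
  have gdeg : g.totalDegree ≤ n + 1 := by
    refine (totalDegree_sub _ _).trans (max_le ?_ ?_)
    · refine (totalDegree_mul _ _).trans ?_
      rw [totalDegree_C, zero_add]
      exact (pr_deg a1).trans a2
    · refine (totalDegree_mul _ _).trans ?_
      rw [totalDegree_C, zero_add]
      exact (pr_deg b1).trans b2
  obtain ⟨g1, hg1, dg1⟩ := line_quot h1.1 g (n + 1) gdeg (on (rm Y L) K1)
    (fun B hB => (mem_on.1 hB).2) (by
      intro B hB
      obtain ⟨hB1, hB2⟩ := mem_on.1 hB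
      rw [gev]
      by_cases hBO : B = O
      · rw [hBO]; ring
      · rw [a4 B hB1 hBO hB2, b4 B hB1 hBO hB2]; ring) (by rw [h1.2]; omega)
  have dg1' : g1.totalDegree ≤ n := by
    rcases dg1 with rfl | h
    · simp
    · omega
  obtain ⟨g2, hg2, dg2⟩ := line_quot h2.1 g1 n dg1' ((on (rm Y L) K2).erase O)
    (fun B hB => (mem_on.1 (Finset.mem_of_mem_erase hB)).2) (by
      intro B hB
      obtain ⟨hB1, hB2⟩ := mem_on.1 (Finset.mem_of_mem_erase hB)
      have hBO := Finset.ne_of_mem_erase hB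
      have e : evalPt g B = 0 := by
        rw [gev, a5 B hB1 hBO hB2, b5 B hB1 hBO hB2]; ring
      rw [hg1, evalPt_mul, mul_eq_zero, lp_zero h1.1] at e
      exact e.resolve_left (fun hB3 => h12 (h1.1.eq_of_two h2.1 hBO hB3 hO1 hB2 hO2)))
    (by
      rw [Finset.card_erase_of_mem (mem_on.2 ⟨hO, hO2⟩), h2.2]
      omega)
  have hfin : evalPt g A' = 0 := by
    rcases dg2 with h0 | dg2
    · rw [hg1, hg2, h0]
      simp [evalPt]
    · have hrL : r ≠ L := by
        rintro rfl
        exact hF.2.2.1 r hr hAL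
      have hcard : n ≤ (rm (((on Y L).erase A).erase A') r).card := by
        have e1 := card_on_add_rm (((on Y L).erase A).erase A') r
        rw [Finset.card_erase_of_mem (Finset.mem_erase.2 ⟨hne.symm, mem_on.2 ⟨hA', hAL'⟩⟩),
          Finset.card_erase_of_mem (mem_on.2 ⟨hA, hAL⟩), hL.2] at e1
        have e2 : (on (((on Y L).erase A).erase A') r).card ≤ 1 := by
          rw [Finset.card_le_one]
          intro P hP Q hQ
          simp only [mem_on, Finset.mem_erase] at hP hQ
          by_contra hPQ
          exact hrL ((hF.2.1 r hr).eq_of_two hL.1 hPQ hP.2 hQ.2 hP.1.2.2.2 hQ.1.2.2.2)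
        omega
      obtain ⟨g3, hg3, -⟩ := line_quot hL.1 g2 (n - 1) (by omega)
        (rm (((on Y L).erase A).erase A') r)
        (fun B hB => by
          simp only [mem_on, mem_rm, Finset.mem_erase] at hB
          exact hB.1.2.2.2) (by
          intro B hB
          simp only [mem_on, mem_rm, Finset.mem_erase] at hB
          obtain ⟨⟨hB1, hB2, hB3, hB4⟩, hB5⟩ := hB
          have e : evalPt g B = 0 := by
            rw [gev, a6 B hB3 hB2 hB5, b6 B hB3 hB1 hB5]; ring
          rw [hg1, hg2, evalPt_mul, evalPt_mul, mul_eq_zero, mul_eq_zero, lp_zero h1.1,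
            lp_zero h2.1] at e
          exact (e.resolve_left (m1 B hB3 hB4)).resolve_left (m2 B hB3 hB4)) (by omega)
      rw [hg1, hg2, hg3, evalPt_mul, evalPt_mul, evalPt_mul, (lp_zero hL.1 A').2 hAL']
      ring
  rw [gev, a6 A' hA' hne.symm (hF'.2.2.1 r hr')] at hfin
  have : evalPt q O * evalPt q' A' = 0 := by linarith
  exact (mul_ne_zero a3 b7) this

lemma rm_comm (Y : Finset Pt) (L M : Set Pt) : rm (rm Y L) M = rm (rm Y M) L := by
  ext P
  simp only [mem_rm]
  tauto

/-- Every node off `M` that is not `A` is covered. -/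
lemma Cov.covers_on {n : ℕ} {Y : Finset Pt} {A : Pt} {F : Finset (Set Pt)} (hF : Cov n Y A F)
    {K : Set Pt} (hA : A ∉ K) : ∀ B ∈ on Y K, ∃ l ∈ F, B ∈ l := by
  intro B hB
  obtain ⟨h1, h2⟩ := mem_on.1 hB
  exact hF.2.2.2 B h1 (by rintro rfl; exact hA h2)

/-- If `K` is a maximal line of `Y \ L` missing `L`, every line of the cover of a node of `L`
hits `K` at a node. -/
lemma hit_node {n : ℕ} {Y : Finset Pt} {L K : Set Pt}
    (hK : Mx n (rm Y L) K) {A : Pt} (hAL : A ∈ L)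
    {F : Finset (Set Pt)} (hF : Cov (n + 1) Y A F) (hKF : K ∉ F) {l : Set Pt} (hl : l ∈ F) :
    ∃ P ∈ rm Y L, P ∈ K ∧ P ∈ l := by
  obtain ⟨P, hP, hPl⟩ := exact_hit hF.2.1 hK.1 hKF (T := on (rm Y L) K) (m := n + 1)
    (fun B hB => (mem_on.1 hB).2) (by
      intro B hB
      obtain ⟨hB1, hB2⟩ := mem_rm.1 (mem_on.1 hB).1
      exact hF.2.2.2 B hB1 (by rintro rfl; exact hB2 hAL)) hF.1 (by rw [hK.2]) hl
  exact ⟨P, (mem_on.1 hP).1, (mem_on.1 hP).2, hPl⟩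

lemma lemD {n : ℕ} {Y : Finset Pt} {L K1 K2 K3 : Set Pt} (h : G (n + 2) Y)
    (hL : Mx (n + 2) Y L)
    (h1 : Mx (n + 1) (rm Y L) K1) (h2 : Mx (n + 1) (rm Y L) K2) (h3 : Mx (n + 1) (rm Y L) K3)
    (h12 : K1 ≠ K2) (h13 : K1 ≠ K3) (h23 : K2 ≠ K3)
    (m1 : Miss Y L K1) (m2 : Miss Y L K2) (m3 : Miss Y L K3) : False := by
  classical
  have hG := G_rm h hL
  obtain ⟨O, hO, hO1, hO2⟩ := mx_common hG h1 h2
  have hO3 : O ∉ K3 := fun hO3 => no3 hG h1 h2 h3 h12 h13 h23 hO1 hO2 hO3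
  have ex : ∀ A ∈ on Y L, ∃ Q ∈ on (rm Y L) K3, ∃ F l, Cov (n + 2) Y A F ∧ l ∈ F ∧ O ∈ l ∧
      Q ∈ l := by
    intro A hA
    obtain ⟨hA1, hA2⟩ := mem_on.1 hA
    obtain ⟨F, hF⟩ := h.2 A hA1
    obtain ⟨hOY, hOL⟩ := mem_rm.1 hO
    obtain ⟨l, hl, hOl⟩ := hF.2.2.2 O hOY (by rintro rfl; exact hOL hA2)
    obtain ⟨Q, hQ, hQ3, hQl⟩ := hit_node h3 hA2 hF (miss_notin hL m3 hA1 hA2 hF) hl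
    exact ⟨Q, mem_on.2 ⟨hQ, hQ3⟩, F, l, hF, hl, hOl, hQl⟩
  choose! q hq using ex
  have hinj : Set.InjOn q (on Y L : Set Pt) := by
    intro A hA A' hA' he
    have hA := Finset.mem_coe.1 hA
    have hA' := Finset.mem_coe.1 hA'
    by_contra hne
    obtain ⟨q1, F, l, hF, hl, hOl, hQl⟩ := hq A hA
    obtain ⟨-, F', l', hF', hl', hOl', hQl'⟩ := hq A' hA'
    have hQO : q A ≠ O := by
      intro e
      exact hO3 (e ▸ (mem_on.1 q1).2)
    have : l = l' := (hF.2.1 l hl).eq_of_two (hF'.2.1 l' hl') hQO hQl hOl (he ▸ hQl') hOl'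
    subst this
    exact key_inj hL h1 h2 h12 m1 m2 hO hO1 hO2 (mem_on.1 hA).1 (mem_on.1 hA).2 (mem_on.1 hA').1
      (mem_on.1 hA').2 hne hF hF' hl hl' hOl
  have := Finset.card_le_card_of_injOn q (fun A hA => (hq A hA).1) hinj
  rw [hL.2, h3.2] at this
  omega

/-- There are three distinct maximal lines. -/
def Three (n : ℕ) (Y : Finset Pt) : Prop :=
  ∃ M1 M2 M3, Mx n Y M1 ∧ Mx n Y M2 ∧ Mx n Y M3 ∧ M1 ≠ M2 ∧ M1 ≠ M3 ∧ M2 ≠ M3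

def CC (n : ℕ) : Prop := ∀ (Y : Finset Pt) (L K1 K2 : Set Pt), G (n + 2) Y → Mx (n + 2) Y L →
  Mx (n + 1) (rm Y L) K1 → Mx (n + 1) (rm Y L) K2 → Miss Y L K1 → Miss Y L K2 → K1 = K2

lemma CC_other {n : ℕ} (IH : n = 0 ∨ ∃ k, n = k + 1 ∧ CC k) {Y : Finset Pt} {L K1 K2 M : Set Pt}
    (h : G (n + 2) Y) (hL : Mx (n + 2) Y L) (hM : Mx (n + 2) Y M) (hLM : L ≠ M)
    (h1 : Mx (n + 1) (rm Y L) K1) (h2 : Mx (n + 1) (rm Y L) K2) (m1 : Miss Y L K1)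
    (m2 : Miss Y L K2) : K1 = K2 := by
  classical
  by_contra h12
  obtain ⟨C, hC, hCL, hCM⟩ := mx_common h hL hM
  have hM1 : M ≠ K1 := by rintro rfl; exact m1 C hC hCL hCM
  have hM2 : M ≠ K2 := by rintro rfl; exact m2 C hC hCL hCM
  have hG := G_rm h hL
  have hM' := mx_rm h hL hM hLM
  rcases IH with rfl | ⟨k, rfl, IH⟩
  · obtain ⟨F, hF⟩ := h.2 C hC
    obtain ⟨O, hO, hO1, hO2⟩ := mx_common hG h1 h2
    have hOM : O ∉ M := fun hOM => no3 hG hM' h1 h2 hM1 hM2 h12 hOM hO1 hO2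
    obtain ⟨hOY, hOL⟩ := mem_rm.1 hO
    obtain ⟨l, hl, hOl⟩ := hF.2.2.2 O hOY (by rintro rfl; exact hOL hCL)
    obtain ⟨Q, hQ, hQM, hQl⟩ := hit_node hM' hCL hF (hF.notin hCM) hl
    obtain ⟨P1, hP1, hP1M, hP1K⟩ := mx_common hG hM' h1
    obtain ⟨P2, hP2, hP2M, hP2K⟩ := mx_common hG hM' h2
    have hP12 : P1 ≠ P2 := by
      rintro rfl
      exact no3 hG hM' h1 h2 hM1 hM2 h12 hP1M hP1K hP2K
    have hQO : Q ≠ O := by rintro rfl; exact hOM hQM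
    have hk1 := miss_notin hL m1 hC hCL hF
    have hk2 := miss_notin hL m2 hC hCL hF
    have hQ1 : Q ≠ P1 := by
      rintro rfl
      exact hk1 (h1.1.eq_of_two (hF.2.1 l hl) hQO hP1K hO1 hQl hOl ▸ hl)
    have hQ2 : Q ≠ P2 := by
      rintro rfl
      exact hk2 (h2.1.eq_of_two (hF.2.1 l hl) hQO hP2K hO2 hQl hOl ▸ hl)
    have hsub : ({Q, P1, P2} : Finset Pt) ⊆ on (rm Y L) M := by
      intro x hx
      simp only [Finset.mem_insert, Finset.mem_singleton] at hx
      rcases hx with rfl | rfl | rfl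
      · exact mem_on.2 ⟨hQ, hQM⟩
      · exact mem_on.2 ⟨hP1, hP1M⟩
      · exact mem_on.2 ⟨hP2, hP2M⟩
    have := Finset.card_le_card hsub
    rw [hM'.2, Finset.card_eq_three.2 ⟨Q, P1, P2, hQ1, hQ2, hP12, rfl⟩] at this
    omega
  · refine h12 (IH (rm Y M) L K1 K2 (G_rm h hM) (mx_rm h hM hL hLM.symm) ?_ ?_ ?_ ?_)
    · rw [← rm_comm]
      exact mx_rm hG hM' h1 hM1
    · rw [← rm_comm]
      exact mx_rm hG hM' h2 hM2
    · exact fun P hP => m1 P (mem_rm.1 hP).1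
    · exact fun P hP => m2 P (mem_rm.1 hP).1

lemma CC_step {n : ℕ} (hCG : ∀ Y, G (n + 1) Y → Three (n + 1) Y)
    (IH : n = 0 ∨ ∃ k, n = k + 1 ∧ CC k) : CC n := by
  intro Y L K1 K2 h hL h1 h2 m1 m2
  by_cases hM : ∃ M, Mx (n + 2) Y M ∧ L ≠ M
  · obtain ⟨M, hM, hLM⟩ := hM
    exact CC_other IH h hL hM hLM h1 h2 m1 m2
  · by_contra h12
    push Not at hM
    have miss : ∀ K, Mx (n + 1) (rm Y L) K → Miss Y L K := by
      intro K hK P hP hPL hPK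
      exact mx_rm_ne hK (hM K (mx_of_hit hL.1 hK hP hPL hPK))
    obtain ⟨J1, J2, J3, j1, j2, j3, j12, j13, j23⟩ := hCG _ (G_rm h hL)
    exact lemD h hL j1 j2 j3 j12 j13 j23 (miss _ j1) (miss _ j2) (miss _ j3)

lemma CG_step {n : ℕ} (hGM : ∀ Y, G (n + 2) Y → ∃ M, Mx (n + 2) Y M)
    (hCG : ∀ Y, G (n + 1) Y → Three (n + 1) Y) (hC : CC n) :
    ∀ Y, G (n + 2) Y → Three (n + 2) Y := by
  intro Y h
  obtain ⟨L, hL⟩ := hGM Y h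
  obtain ⟨J1, J2, J3, j1, j2, j3, j12, j13, j23⟩ := hCG _ (G_rm h hL)
  have dich : ∀ K, Mx (n + 1) (rm Y L) K → Miss Y L K ∨ Mx (n + 2) Y K := by
    intro K hK
    by_cases hm : Miss Y L K
    · exact Or.inl hm
    · unfold Miss at hm
      push Not at hm
      obtain ⟨P, hP, hPL, hPK⟩ := hm
      exact Or.inr (mx_of_hit hL.1 hK hP hPL hPK)
  have l1 := mx_rm_ne j1
  have l2 := mx_rm_ne j2
  have l3 := mx_rm_ne j3
  rcases dich _ j1 with a1 | a1
  · rcases dich _ j2 with a2 | a2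
    · exact absurd (hC Y L _ _ h hL j1 j2 a1 a2) j12
    · rcases dich _ j3 with a3 | a3
      · exact absurd (hC Y L _ _ h hL j1 j3 a1 a3) j13
      · exact ⟨L, J2, J3, hL, a2, a3, l2, l3, j23⟩
  · rcases dich _ j2 with a2 | a2
    · rcases dich _ j3 with a3 | a3
      · exact absurd (hC Y L _ _ h hL j2 j3 a2 a3) j23
      · exact ⟨L, J1, J3, hL, a1, a3, l1, l3, j13⟩
    · exact ⟨L, J1, J2, hL, a1, a2, l1, l2, j12⟩

lemma CG_one : ∀ Y, G 1 Y → Three 1 Y := by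
  classical
  intro Y h
  have hc : Y.card = 3 := by rw [h.1.1]; decide
  obtain ⟨A, B, C, hAB, hAC, hBC, rfl⟩ := Finset.card_eq_three.1 hc
  have side : ∀ P Q R : Pt, ({A, B, C} : Finset Pt) = {P, Q, R} → P ≠ Q → P ≠ R → Q ≠ R →
      ∃ l, Mx 1 ({A, B, C} : Finset Pt) l ∧ P ∉ l ∧ Q ∈ l ∧ R ∈ l := by
    intro P Q R he hPQ hPR hQR
    rw [he] at h ⊢
    obtain ⟨F, hF⟩ := h.2 P (by simp)
    obtain ⟨l, hl, hQl⟩ := hF.2.2.2 Q (by simp) hPQ.symm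
    obtain ⟨l', hl', hRl⟩ := hF.2.2.2 R (by simp) hPR.symm
    have := Finset.card_le_one.1 hF.1 l hl l' hl'
    subst this
    refine ⟨l, ⟨hF.2.1 l hl, ?_⟩, hF.2.2.1 l hl, hQl, hRl⟩
    have : on ({P, Q, R} : Finset Pt) l = {Q, R} := by
      ext x
      simp only [mem_on, Finset.mem_insert, Finset.mem_singleton]
      constructor
      · rintro ⟨rfl | hx, hxl⟩
        · exact absurd hxl (hF.2.2.1 l hl)
        · exact hx
      · rintro (rfl | rfl)
        · exact ⟨by simp, hQl⟩
        · exact ⟨by simp, hRl⟩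
    rw [this, Finset.card_pair hQR]
  obtain ⟨a, ha, a1, a2, a3⟩ := side A B C rfl hAB hAC hBC
  obtain ⟨b, hb, b1, b2, b3⟩ := side B A C (by ext x; simp; tauto) hAB.symm hBC hAC
  obtain ⟨c, hc, c1, c2, c3⟩ := side C A B (by ext x; simp; tauto) hAC.symm hBC.symm hAB
  exact ⟨a, b, c, ha, hb, hc, by rintro rfl; exact a1 b2, by rintro rfl; exact a1 c2,
    by rintro rfl; exact b1 c3⟩

lemma CG_CC {N : ℕ} (hN : GMC N) (n : ℕ) :
    (n + 1 ≤ N → ∀ Y, G (n + 1) Y → Three (n + 1) Y) ∧ (n + 2 ≤ N → CC n) := by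
  induction n with
  | zero => exact ⟨fun _ => CG_one, fun _ => CC_step CG_one (Or.inl rfl)⟩
  | succ k ih =>
    have hCG : k + 2 ≤ N → ∀ Y, G (k + 2) Y → Three (k + 2) Y := fun hk =>
      CG_step (hN (k + 2) hk) (ih.1 (by omega)) (ih.2 hk)
    exact ⟨hCG, fun hk => CC_step (hCG (by omega)) (Or.inr ⟨k, rfl, ih.2 (by omega)⟩)⟩

lemma CG {N : ℕ} (hN : GMC N) {n : ℕ} (hn : n + 1 ≤ N) {Y : Finset Pt} (h : G (n + 1) Y) :
    Three (n + 1) Y := (CG_CC hN n).1 hn Y h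

lemma claimC {N : ℕ} (hN : GMC N) {n : ℕ} (hn : n + 2 ≤ N) : CC n := (CG_CC hN n).2 hn

lemma uses_rm {n : ℕ} {X : Finset Pt} {M l : Set Pt} (hM : Mx (n + 1) X M)
    (hne : M ≠ l) {A : Pt} (hA : A ∉ M) : UsesC (n + 1) X l A ↔ UsesC n (rm X M) l A := by
  classical
  constructor
  · rintro ⟨F, hF, hl⟩
    exact ⟨F.erase M, cov_erase hF (mx_mem hM hF hA), Finset.mem_erase.2 ⟨hne.symm, hl⟩⟩
  · rintro ⟨F, hF, hl⟩
    exact ⟨insert M F, cov_insert hF hM.1 hA, Finset.mem_insert_of_mem hl⟩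

lemma uses_mx {n : ℕ} {Y : Finset Pt} {l : Set Pt} (h : G n Y) (hl : Mx n Y l) {A : Pt}
    (hA : A ∈ Y) : UsesC n Y l A ↔ A ∉ l := by
  constructor
  · rintro ⟨F, hF, hlF⟩
    exact hF.2.2.1 l hlF
  · intro hAl
    obtain ⟨F, hF⟩ := h.2 A hA
    exact ⟨F, hF, mx_mem hl hF hAl⟩

lemma mx_ne_of_card {n : ℕ} {X : Finset Pt} {M l : Set Pt} (hM : Mx n X M)
    (hc : (on X l).card = n) : M ≠ l := by
  rintro rfl
  have := hM.2
  omega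

lemma mx_of_miss {n : ℕ} {X : Finset Pt} {M l : Set Pt} (hl : IsLine l)
    (hc : (on X l).card = n + 1) (hm : Miss X M l) : Mx n (rm X M) l := by
  refine ⟨hl, ?_⟩
  rw [on_rm_miss hm, hc]

lemma usesA {n : ℕ} {X : Finset Pt} {M l : Set Pt} (h : G (n + 1) X) (hl : IsLine l)
    (hc : (on X l).card = n + 1) (hM : Mx (n + 1) X M) (hm : Miss X M l) {A : Pt} (hA : A ∈ X) :
    UsesC (n + 1) X l A ↔ A ∉ M ∧ A ∉ l := by
  by_cases hAM : A ∈ M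
  · constructor
    · rintro ⟨F, hF, hlF⟩
      exact absurd hlF (miss_notin hM hm hA hAM hF)
    · rintro ⟨h1, -⟩
      exact absurd hAM h1
  · rw [uses_rm hM (mx_ne_of_card hM hc) hAM,
      uses_mx (G_rm h hM) (mx_of_miss hl hc hm) (mem_rm.2 ⟨hA, hAM⟩)]
    tauto

/-- Setup of case B: removing `M1` reduces to case A. -/
lemma caseB_red {n : ℕ} {X : Finset Pt} {M1 M2 l : Set Pt} (h : G (n + 2) X) (hl : IsLine l)
    (hc : (on X l).card = n + 2) (h1 : Mx (n + 2) X M1) (h2 : Mx (n + 2) X M2) (h12 : M1 ≠ M2)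
    {P : Pt} (hP : P ∈ X) (p1 : P ∈ M1) (p2 : P ∈ M2) (pl : P ∈ l) :
    (on (rm X M1) l).card = n + 1 ∧ Mx (n + 1) (rm X M1) M2 ∧ Miss (rm X M1) M2 l := by
  have e := on_rm_card h1.1 hl (mx_ne_of_card h1 hc) hP p1 pl
  refine ⟨by omega, mx_rm h h1 h2 h12, ?_⟩
  intro Q hQ hQ2 hQl
  have hPQ : P ≠ Q := by
    rintro rfl
    exact (mem_rm.1 hQ).2 p1
  exact mx_ne_of_card h2 hc (h2.1.eq_of_two hl hPQ p2 hQ2 pl hQl)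

lemma usesB {n : ℕ} {X : Finset Pt} {M1 M2 l : Set Pt} (h : G (n + 2) X) (hl : IsLine l)
    (hc : (on X l).card = n + 2) (h1 : Mx (n + 2) X M1) (h2 : Mx (n + 2) X M2) (h12 : M1 ≠ M2)
    {P : Pt} (hP : P ∈ X) (p1 : P ∈ M1) (p2 : P ∈ M2) (pl : P ∈ l) {A : Pt} (hA : A ∈ X) :
    UsesC (n + 2) X l A ↔ (A ∉ M1 ∧ A ∉ M2) ∧ A ∉ l := by
  have key : ∀ M1 M2, Mx (n + 2) X M1 → Mx (n + 2) X M2 → M1 ≠ M2 → P ∈ M1 → P ∈ M2 →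
      A ∉ M1 → (UsesC (n + 2) X l A ↔ (A ∉ M1 ∧ A ∉ M2) ∧ A ∉ l) := by
    intro M1 M2 h1 h2 h12 p1 p2 hA1
    obtain ⟨r1, r2, r3⟩ := caseB_red h hl hc h1 h2 h12 hP p1 p2 pl
    rw [uses_rm h1 (mx_ne_of_card h1 hc) hA1,
      usesA (G_rm h h1) hl r1 r2 r3 (mem_rm.2 ⟨hA, hA1⟩)]
    tauto
  by_cases hA1 : A ∈ M1
  · by_cases hA2 : A ∈ M2
    · have : A = P := by
        by_contra hAP
        exact h12 (h1.1.eq_of_two h2.1 hAP hA1 p1 hA2 p2)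
      subst this
      constructor
      · rintro ⟨F, hF, hlF⟩
        exact absurd pl (hF.2.2.1 l hlF)
      · tauto
    · rw [key M2 M1 h2 h1 h12.symm p2 p1 hA2]
      tauto
  · exact key M1 M2 h1 h2 h12 p1 p2 hA1

def TA (n : ℕ) (X : Finset Pt) (l : Set Pt) : Prop := ∃ M, Mx n X M ∧ Miss X M l

def TB (n : ℕ) (X : Finset Pt) (l : Set Pt) : Prop :=
  ∃ M1 M2, Mx n X M1 ∧ Mx n X M2 ∧ M1 ≠ M2 ∧ ∃ P ∈ X, P ∈ M1 ∧ P ∈ M2 ∧ P ∈ l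

lemma choose_aux (n : ℕ) : (n + 2).choose 2 = (n + 1) + (n + 1).choose 2 := by
  rw [Nat.choose_succ_succ (n + 1) 1, Nat.choose_one_right]

lemma countA {n : ℕ} {X : Finset Pt} {l : Set Pt} (h : G (n + 1) X) (hl : IsLine l)
    (hc : (on X l).card = n + 1) (hT : TA (n + 1) X l) :
    ∃ S : Finset Pt, (∀ A, A ∈ S ↔ A ∈ X ∧ UsesC (n + 1) X l A) ∧
      S.card = (n + 1).choose 2 := by
  obtain ⟨M, hM, hm⟩ := hT
  refine ⟨rm (rm X M) l, ?_, ?_⟩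
  · intro A
    rw [mem_rm, mem_rm]
    constructor
    · rintro ⟨⟨a, b⟩, c⟩
      exact ⟨a, (usesA h hl hc hM hm a).2 ⟨b, c⟩⟩
    · rintro ⟨a, b⟩
      have := (usesA h hl hc hM hm a).1 b
      exact ⟨⟨a, this.1⟩, this.2⟩
  · have e := card_on_add_rm (rm X M) l
    rw [(G_rm h hM).1.1, (mx_of_miss hl hc hm).2, choose_aux] at e
    omega

lemma countB {n : ℕ} {X : Finset Pt} {l : Set Pt} (h : G (n + 2) X) (hl : IsLine l)
    (hc : (on X l).card = n + 2) (hT : TB (n + 2) X l) :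
    ∃ S : Finset Pt, (∀ A, A ∈ S ↔ A ∈ X ∧ UsesC (n + 2) X l A) ∧
      S.card = (n + 1).choose 2 := by
  obtain ⟨M1, M2, h1, h2, h12, P, hP, p1, p2, pl⟩ := hT
  obtain ⟨r1, r2, r3⟩ := caseB_red h hl hc h1 h2 h12 hP p1 p2 pl
  refine ⟨rm (rm (rm X M1) M2) l, ?_, ?_⟩
  · intro A
    rw [mem_rm, mem_rm, mem_rm]
    constructor
    · rintro ⟨⟨⟨a, b⟩, c⟩, d⟩
      exact ⟨a, (usesB h hl hc h1 h2 h12 hP p1 p2 pl a).2 ⟨⟨b, c⟩, d⟩⟩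
    · rintro ⟨a, b⟩
      have := (usesB h hl hc h1 h2 h12 hP p1 p2 pl a).1 b
      exact ⟨⟨⟨a, this.1.1⟩, this.1.2⟩, this.2⟩
  · have e := card_on_add_rm (rm (rm X M1) M2) l
    rw [(G_rm (G_rm h h1) r2).1.1, (mx_of_miss hl r1 r3).2, choose_aux] at e
    omega

lemma count_one {X : Finset Pt} {l : Set Pt} (h : G 1 X)
    (hc : (on X l).card = 1) : ∀ A, A ∈ X → ¬ UsesC 1 X l A := by
  classical
  rintro A hA ⟨F, hF, hlF⟩
  have hsub : X.erase A ⊆ on X l := by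
    intro B hB
    obtain ⟨l', h1, h2⟩ := hF.2.2.2 B (Finset.mem_of_mem_erase hB) (Finset.ne_of_mem_erase hB)
    have := Finset.card_le_one.1 hF.1 l hlF l' h1
    subst this
    exact mem_on.2 ⟨Finset.mem_of_mem_erase hB, h2⟩
  have := Finset.card_le_card hsub
  rw [Finset.card_erase_of_mem hA, h.1.1, hc] at this
  revert this
  decide

lemma deg_two {X : Finset Pt} {l : Set Pt} (hT : Three 2 X)
    (hc : (on X l).card = 2) : TA 2 X l ∨ TB 2 X l := by
  classical
  by_contra hn
  push Not at hn
  obtain ⟨hA, hB⟩ := hn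
  obtain ⟨M1, M2, M3, h1, h2, h3, h12, h13, h23⟩ := hT
  have hit : ∀ M, Mx 2 X M → ∃ P ∈ X, P ∈ M ∧ P ∈ l := by
    intro M hM
    by_contra hno
    push Not at hno
    exact hA ⟨M, hM, hno⟩
  obtain ⟨P1, a1, b1, c1⟩ := hit M1 h1
  obtain ⟨P2, a2, b2, c2⟩ := hit M2 h2
  obtain ⟨P3, a3, b3, c3⟩ := hit M3 h3
  have e12 : P1 ≠ P2 := by rintro rfl; exact hB ⟨M1, M2, h1, h2, h12, P1, a1, b1, b2, c1⟩
  have e13 : P1 ≠ P3 := by rintro rfl; exact hB ⟨M1, M3, h1, h3, h13, P1, a1, b1, b3, c1⟩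
  have e23 : P2 ≠ P3 := by rintro rfl; exact hB ⟨M2, M3, h2, h3, h23, P2, a2, b2, b3, c2⟩
  have hsub : ({P1, P2, P3} : Finset Pt) ⊆ on X l := by
    intro x hx
    simp only [Finset.mem_insert, Finset.mem_singleton] at hx
    rcases hx with rfl | rfl | rfl
    · exact mem_on.2 ⟨a1, c1⟩
    · exact mem_on.2 ⟨a2, c2⟩
    · exact mem_on.2 ⟨a3, c3⟩
  have := Finset.card_le_card hsub
  rw [hc, Finset.card_eq_three.2 ⟨P1, P2, P3, e12, e13, e23, rfl⟩] at this
  omega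

lemma on_le_one {Y : Finset Pt} {K a : Set Pt} (hK : IsLine K) (ha : IsLine a) (hne : K ≠ a) :
    (on (on Y K) a).card ≤ 1 := by
  rw [Finset.card_le_one]
  intro P hP Q hQ
  simp only [mem_on] at hP hQ
  by_contra hPQ
  exact hne (hK.eq_of_two ha hPQ hP.1.2 hQ.1.2 hP.2 hQ.2)

lemma two_left {Y : Finset Pt} {K a b : Set Pt} (hK : IsLine K) (ha : IsLine a) (hb : IsLine b)
    (hKa : K ≠ a) (hKb : K ≠ b) (hc : 4 ≤ (on Y K).card) :
    ∃ A B, A ≠ B ∧ (A ∈ Y ∧ A ∈ K ∧ A ∉ a ∧ A ∉ b) ∧ (B ∈ Y ∧ B ∈ K ∧ B ∉ a ∧ B ∉ b) := by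
  have e1 := card_on_add_rm (on Y K) a
  have e2 := card_on_add_rm (rm (on Y K) a) b
  have e3 := on_le_one (Y := Y) hK ha hKa
  have e4 : (on (rm (on Y K) a) b).card ≤ (on (on Y K) b).card := by
    apply Finset.card_le_card
    intro x hx
    simp only [mem_on, mem_rm] at hx ⊢
    tauto
  have e5 := on_le_one (Y := Y) hK hb hKb
  obtain ⟨A, hA, B, hB, hAB⟩ := Finset.one_lt_card.1
    (show 1 < (rm (rm (on Y K) a) b).card by omega)
  simp only [mem_on, mem_rm] at hA hB
  exact ⟨A, B, hAB, by tauto, by tauto⟩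

/-- The node `A` is off `l` and does not use `l`. -/
def NU (n : ℕ) (X : Finset Pt) (l : Set Pt) (A : Pt) : Prop := A ∉ l ∧ ¬ UsesC n X l A

lemma hit_of_nTA {n : ℕ} {X : Finset Pt} {l M : Set Pt} (hA : ¬ TA n X l) (hM : Mx n X M) :
    ∃ P ∈ X, P ∈ M ∧ P ∈ l := by
  by_contra hno
  push Not at hno
  exact hA ⟨M, hM, hno⟩

/-- Outcome (a) or (b) for a maximal line `M`. -/
lemma outcome {d : ℕ} (hC : CC (d + 1)) {X : Finset Pt} {l M : Set Pt} (h : G (d + 3) X)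
    (hl : IsLine l) (hc : (on X l).card = d + 3) (hA : ¬ TA (d + 3) X l) (hB : ¬ TB (d + 3) X l)
    (hM : Mx (d + 3) X M) (hT : TA (d + 2) (rm X M) l ∨ TB (d + 2) (rm X M) l) :
    (∃ K, Mx (d + 2) (rm X M) K ∧ Miss X M K ∧ (∀ B ∈ X, B ∉ M → NU (d + 3) X l B → B ∈ K) ∧
      (∀ B ∈ X, B ∈ M → B ∉ l → NU (d + 3) X l B)) ∨
    (∃ K J, Mx (d + 2) (rm X M) K ∧ Miss X M K ∧ Mx (d + 3) X J ∧ M ≠ J ∧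
      (∃ P ∈ X, P ∈ K ∧ P ∈ J ∧ P ∈ l) ∧
      (∀ B ∈ X, B ∉ M → (NU (d + 3) X l B ↔ B ∉ l ∧ (B ∈ K ∨ B ∈ J)))) := by
  classical
  have hMl := mx_ne_of_card hM hc
  obtain ⟨C, hCX, hCM, hCl⟩ := hit_of_nTA hA hM
  have hc' : (on (rm X M) l).card = d + 2 := by
    have := on_rm_card hM.1 hl hMl hCX hCM hCl
    omega
  have hG := G_rm h hM
  have miss_or : ∀ K, Mx (d + 2) (rm X M) K → Miss X M K ∨ Mx (d + 3) X K := by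
    intro K hK
    by_cases hm : Miss X M K
    · exact Or.inl hm
    · unfold Miss at hm
      push Not at hm
      obtain ⟨P, hP, hPL, hPK⟩ := hm
      exact Or.inr (mx_of_hit hM.1 hK hP hPL hPK)
  rcases hT with ⟨K, hK, hm⟩ | ⟨J1, J2, j1, j2, j12, P, hP, p1, p2, pl⟩
  · left
    have hMK := mx_rm_ne hK
    have hmK : Miss X M K := by
      rcases miss_or K hK with hmm | hmx
      · exact hmm
      · exfalso
        obtain ⟨P, hP, hPK, hPl⟩ := hit_of_nTA hA hmx
        have hPM : P ∈ M := by
          by_contra hPM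
          exact hm P (mem_rm.2 ⟨hP, hPM⟩) hPK hPl
        exact hB ⟨M, K, hM, hmx, hMK, P, hP, hPM, hPK, hPl⟩
    refine ⟨K, hK, hmK, ?_, ?_⟩
    · intro B hBX hBM hNU
      by_contra hBK
      apply hNU.2
      rw [uses_rm hM hMl hBM, usesA hG hl hc' hK hm (mem_rm.2 ⟨hBX, hBM⟩)]
      exact ⟨hBK, hNU.1⟩
    · intro B hBX hBM hBl
      refine ⟨hBl, ?_⟩
      rintro ⟨F, hF, hlF⟩
      have hKF := miss_notin hM hmK hBX hBM hF
      have := pigeon (F := F.erase l) (fun l hl => hF.2.1 l (Finset.mem_of_mem_erase hl)) hK.1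
        (fun hx => hKF (Finset.mem_of_mem_erase hx)) (T := on (rm X M) K)
        (fun B hB => (mem_on.1 hB).2) (by
          intro Q hQ
          obtain ⟨q1, q2⟩ := mem_on.1 hQ
          obtain ⟨l', a, b⟩ := hF.2.2.2 Q (mem_rm.1 q1).1 (by
            rintro rfl; exact (mem_rm.1 q1).2 hBM)
          exact ⟨l', Finset.mem_erase.2 ⟨by rintro rfl; exact hm Q q1 q2 b, a⟩, b⟩)
      rw [Finset.card_erase_of_mem hlF, hK.2] at this
      have := hF.1
      omega
  · right
    have fin : ∀ K J, Mx (d + 2) (rm X M) K → Mx (d + 2) (rm X M) J → K ≠ J → P ∈ K → P ∈ J →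
        ∀ B ∈ X, B ∉ M → (NU (d + 3) X l B ↔ B ∉ l ∧ (B ∈ K ∨ B ∈ J)) := by
      intro K J hK hJ hKJ pK pJ B hBX hBM
      unfold NU
      rw [uses_rm hM hMl hBM, usesB hG hl hc' hK hJ hKJ hP pK pJ pl (mem_rm.2 ⟨hBX, hBM⟩)]
      tauto
    have hPX := (mem_rm.1 hP).1
    rcases miss_or J1 j1 with a1 | a1
    · rcases miss_or J2 j2 with a2 | a2
      · exact absurd (hC X M J1 J2 h hM j1 j2 a1 a2) j12
      · exact ⟨J1, J2, j1, a1, a2, mx_rm_ne j2, ⟨P, hPX, p1, p2, pl⟩,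
          fin J1 J2 j1 j2 j12 p1 p2⟩
    · rcases miss_or J2 j2 with a2 | a2
      · exact ⟨J2, J1, j2, a2, a1, mx_rm_ne j1, ⟨P, hPX, p2, p1, pl⟩,
          fin J2 J1 j2 j1 j12.symm p2 p1⟩
      · exact absurd ⟨J1, J2, a1, a2, j12, P, hPX, p1, p2, pl⟩ hB

lemma E_step {d : ℕ} (hC : CC (d + 1)) (h3 : ∀ Y, G (d + 3) Y → Three (d + 3) Y) (hd : 2 ≤ d)
    (IH : ∀ (Y : Finset Pt) (l : Set Pt), G (d + 2) Y → IsLine l → (on Y l).card = d + 2 →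
      TA (d + 2) Y l ∨ TB (d + 2) Y l)
    (X : Finset Pt) (l : Set Pt) (h : G (d + 3) X) (hl : IsLine l) (hc : (on X l).card = d + 3) :
    TA (d + 3) X l ∨ TB (d + 3) X l := by
  by_contra hn
  push Not at hn
  obtain ⟨hA, hB⟩ := hn
  have T : ∀ M, Mx (d + 3) X M → _ := fun M hM => outcome hC h hl hc hA hB hM (by
    obtain ⟨C, hCX, hCM, hCl⟩ := hit_of_nTA hA hM
    have := on_rm_card hM.1 hl (mx_ne_of_card hM hc) hCX hCM hCl
    exact IH (rm X M) l (G_rm h hM) hl (by omega))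
  -- case (b) is impossible
  have nb : ∀ M, Mx (d + 3) X M → ∀ K J, Mx (d + 2) (rm X M) K → Miss X M K → Mx (d + 3) X J →
      M ≠ J → (∃ P ∈ X, P ∈ K ∧ P ∈ J ∧ P ∈ l) →
      (∀ B ∈ X, B ∉ M → (NU (d + 3) X l B ↔ B ∉ l ∧ (B ∈ K ∨ B ∈ J))) → False := by
    rintro M hM K J hK hMK hJ hMJ ⟨P, hP, pK, pJ, pl⟩ hNU
    have hKl : K ≠ l := by
      rintro rfl
      obtain ⟨C, hCX, hCM, hCl⟩ := hit_of_nTA hA hM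
      exact hMK C hCX hCM hCl
    have hKmx : ∀ J', Mx (d + 3) X J' → K ≠ J' := by
      rintro J' hJ' rfl
      obtain ⟨C, hCX, hCM, hCl⟩ := mx_common h hM hJ'
      exact hMK C hCX hCM hCl
    have hKJ := hKmx J hJ
    have fin : ∀ K2 A B, IsLine K2 → Miss X J K2 → A ≠ B → A ∈ K → B ∈ K → A ∈ K2 → B ∈ K2 →
        False := by
      intro K2 A B hK2 hm hAB a b a' b'
      have := hK.1.eq_of_two hK2 hAB a b a' b'
      subst this
      exact hm P hP pJ pK
    have offJ : ∀ A, A ∈ K → A ∉ l → A ∉ J := by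
      intro A aK al aJ
      have hne : A ≠ P := by rintro rfl; exact al pl
      exact hKJ (hK.1.eq_of_two hJ.1 hne aK pK aJ pJ)
    have hcK : 4 ≤ (on (rm X M) K).card := by rw [hK.2]; omega
    rcases T J hJ with ⟨K2, hK2, hm2, h2, -⟩ | ⟨K2, J', hK2, hm2, hJ', -, -, h2⟩
    · obtain ⟨A, B, hAB, ⟨a1, a2, a3, -⟩, ⟨b1, b2, b3, -⟩⟩ :=
        two_left hK.1 hl hl hKl hKl hcK
      have go : ∀ A, A ∈ rm X M → A ∈ K → A ∉ l → A ∈ K2 := by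
        intro A a1 a2 a3
        obtain ⟨a1, a4⟩ := mem_rm.1 a1
        exact h2 A a1 (offJ A a2 a3) ((hNU A a1 a4).2 ⟨a3, Or.inl a2⟩)
      exact fin K2 A B hK2.1 hm2 hAB a2 b2 (go A a1 a2 a3) (go B b1 b2 b3)
    · obtain ⟨A, B, hAB, ⟨a1, a2, a3, a4⟩, ⟨b1, b2, b3, b4⟩⟩ :=
        two_left hK.1 hl hJ'.1 hKl (hKmx J' hJ') hcK
      have go : ∀ A, A ∈ rm X M → A ∈ K → A ∉ l → A ∉ J' → A ∈ K2 := by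
        intro A a1 a2 a3 a5
        obtain ⟨a1, a4⟩ := mem_rm.1 a1
        exact (((h2 A a1 (offJ A a2 a3)).1 ((hNU A a1 a4).2 ⟨a3, Or.inl a2⟩)).2).resolve_right a5
      exact fin K2 A B hK2.1 hm2 hAB a2 b2 (go A a1 a2 a3 a4) (go B b1 b2 b3 b4)
  obtain ⟨M1, M2, -, h1, h2, -, h12, -, -⟩ := h3 X h
  rcases T M1 h1 with ⟨K1, -, -, -, r1⟩ | ⟨K, J, a1, a2, a3, a4, a5, a6⟩
  · rcases T M2 h2 with ⟨K2, k2, m2, r2, -⟩ | ⟨K, J, a1, a2, a3, a4, a5, a6⟩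
    · obtain ⟨A, B, hAB, ⟨a1, a2, a3, a4⟩, ⟨b1, b2, b3, b4⟩⟩ :=
        two_left (Y := X) h1.1 hl h2.1 (mx_ne_of_card h1 hc) h12 (by rw [h1.2]; omega)
      have := h1.1.eq_of_two k2.1 hAB a2 b2 (r2 A a1 a4 (r1 A a1 a2 a3))
        (r2 B b1 b4 (r1 B b1 b2 b3))
      subst this
      obtain ⟨C, c1, c2, c3⟩ := mx_common h h1 h2
      exact m2 C c1 c3 c2
    · exact nb M2 h2 K J a1 a2 a3 a4 a5 a6
  · exact nb M1 h1 K J a1 a2 a3 a4 a5 a6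

/-- The line `s` contains a node of `i` lying off `j` and `k`. -/
def Hit (X : Finset Pt) (i j k s : Set Pt) : Prop := ∃ P ∈ X, P ∈ i ∧ P ∉ j ∧ P ∉ k ∧ P ∈ s

lemma Hit.symm {X : Finset Pt} {i j k s : Set Pt} (h : Hit X i j k s) : Hit X i k j s := by
  obtain ⟨P, a, b, c, d, e⟩ := h
  exact ⟨P, a, b, d, c, e⟩

lemma hit_comm {X : Finset Pt} {i j k s : Set Pt} : Hit X i j k s ↔ Hit X i k j s :=
  ⟨Hit.symm, Hit.symm⟩

/-- The degree four configuration. -/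
structure Cfg (X : Finset Pt) (l : Set Pt) (D : Finset Pt) (i j k : Set Pt) (Ci Cj Ck C4 : Pt)
    (u v w : Set Pt) (T R : Pt) : Prop where
  hC : CC 0
  hG : G 4 X
  hl : IsLine l
  mxi : Mx 4 X i
  mxj : Mx 4 X j
  mxk : Mx 4 X k
  ij : i ≠ j
  ik : i ≠ k
  jk : j ≠ k
  ci : Ci ∈ X ∧ Ci ∈ i ∧ Ci ∈ l ∧ Ci ∉ j ∧ Ci ∉ k
  cj : Cj ∈ X ∧ Cj ∈ j ∧ Cj ∈ l ∧ Cj ∉ i ∧ Cj ∉ k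
  ck : Ck ∈ X ∧ Ck ∈ k ∧ Ck ∈ l ∧ Ck ∉ i ∧ Ck ∉ j
  hD : D = rm (rm (rm X i) j) k
  mu : Mx 1 D u
  mv : Mx 1 D v
  mw : Mx 1 D w
  uv : u ≠ v
  uw : u ≠ w
  vw : v ≠ w
  c4 : C4 ∈ D ∧ C4 ∈ l ∧ C4 ∈ u ∧ C4 ∈ v ∧ C4 ∉ w
  hT : T ∈ D ∧ T ∈ v ∧ T ∈ w ∧ T ∉ l ∧ T ∉ u
  hR : R ∈ D ∧ R ∈ u ∧ R ∈ w ∧ R ∉ l ∧ R ∉ v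

namespace Cfg

variable {X : Finset Pt} {l : Set Pt} {D : Finset Pt} {i j k : Set Pt} {Ci Cj Ck C4 : Pt}
    {u v w : Set Pt} {T R : Pt}

lemma sij (c : Cfg X l D i j k Ci Cj Ck C4 u v w T R) :
    Cfg X l D j i k Cj Ci Ck C4 u v w T R :=
  { c with
    mxi := c.mxj, mxj := c.mxi, ij := c.ij.symm, ik := c.jk, jk := c.ik, ci := c.cj, cj := c.ci
    ck := by have := c.ck; tauto
    hD := by rw [c.hD, rm_comm X] }

lemma sjk (c : Cfg X l D i j k Ci Cj Ck C4 u v w T R) :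
    Cfg X l D i k j Ci Ck Cj C4 u v w T R :=
  { c with
    mxj := c.mxk, mxk := c.mxj, ij := c.ik, ik := c.ij, jk := c.jk.symm
    ci := by have := c.ci; tauto
    cj := c.ck, ck := c.cj
    hD := by rw [c.hD, rm_comm (rm X i)] }

lemma suv (c : Cfg X l D i j k Ci Cj Ck C4 u v w T R) :
    Cfg X l D i j k Ci Cj Ck C4 v u w R T :=
  { c with
    mu := c.mv, mv := c.mu, uv := c.uv.symm, uw := c.vw, vw := c.uw
    c4 := by have := c.c4; tauto
    hT := c.hR, hR := c.hT }

lemma memD (c : Cfg X l D i j k Ci Cj Ck C4 u v w T R) {P : Pt} :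
    P ∈ D ↔ P ∈ X ∧ P ∉ i ∧ P ∉ j ∧ P ∉ k := by
  rw [c.hD]
  simp only [mem_rm]
  tauto

/-- Claim C: at most one side misses `i`. -/
lemma one_miss (c : Cfg X l D i j k Ci Cj Ck C4 u v w T R) {s t : Set Pt} (hs : Mx 1 D s)
    (ht : Mx 1 D t) (hst : s ≠ t) (h : ¬ Hit X i j k s) : Hit X i j k t := by
  by_contra h'
  have h1 := mx_rm c.hG c.mxj c.mxi c.ij.symm
  have h2 := mx_rm c.hG c.mxj c.mxk c.jk
  have g1 := G_rm c.hG c.mxj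
  have e : D = rm (rm (rm X j) k) i := by
    rw [c.hD, rm_comm X, rm_comm (rm X j)]
  rw [e] at hs ht
  refine hst (c.hC (rm (rm X j) k) i s t (G_rm g1 h2) (mx_rm g1 h2 h1 c.ik.symm) hs ht ?_ ?_)
  · intro P hP hPi hPs
    simp only [mem_rm] at hP
    exact h ⟨P, hP.1.1, hPi, hP.1.2, hP.2, hPs⟩
  · intro P hP hPi hPs
    simp only [mem_rm] at hP
    exact h' ⟨P, hP.1.1, hPi, hP.1.2, hP.2, hPs⟩

/-- A side hitting `j` and `k` is maximal after removing `i`. -/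
lemma mx3 (c : Cfg X l D i j k Ci Cj Ck C4 u v w T R) {s : Set Pt} (hs : Mx 1 D s)
    (hj : Hit X j i k s) (hk : Hit X k i j s) : Mx 3 (rm X i) s := by
  rw [c.hD] at hs
  obtain ⟨P, p1, p2, p3, p4, p5⟩ := hk
  obtain ⟨Q, q1, q2, q3, q4, q5⟩ := hj
  have h2 := mx_of_hit c.mxk.1 hs (mem_rm.2 ⟨mem_rm.2 ⟨p1, p3⟩, p4⟩) p2 p5
  exact mx_of_hit c.mxj.1 h2 (mem_rm.2 ⟨q1, q3⟩) q2 q5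

lemma mx4 (c : Cfg X l D i j k Ci Cj Ck C4 u v w T R) {s : Set Pt} (hs : Mx 1 D s)
    (hi : Hit X i j k s) (hj : Hit X j i k s) (hk : Hit X k i j s) : Mx 4 X s := by
  obtain ⟨P, p1, p2, p3, p4, p5⟩ := hi
  exact mx_of_hit c.mxi.1 (c.mx3 hs hj hk) p1 p2 p5

lemma ul (c : Cfg X l D i j k Ci Cj Ck C4 u v w T R) : u ≠ l := by
  rintro rfl
  exact c.hR.2.2.2.1 c.hR.2.1

lemma vl (c : Cfg X l D i j k Ci Cj Ck C4 u v w T R) : v ≠ l := c.suv.ul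

lemma wl (c : Cfg X l D i j k Ci Cj Ck C4 u v w T R) : w ≠ l := by
  rintro rfl
  exact c.hR.2.2.2.1 c.hR.2.2.1

/-- Two different lines through a node of `D` have no common point on `i`. -/
lemma off_i (c : Cfg X l D i j k Ci Cj Ck C4 u v w T R) {s t : Set Pt} (hs : IsLine s)
    (ht : IsLine t) (hst : s ≠ t) {Q P : Pt} (hQ : Q ∈ D) (qs : Q ∈ s) (qt : Q ∈ t)
    (pi : P ∈ i) (ps : P ∈ s) (pt : P ∈ t) : False := by
  have hne : P ≠ Q := by
    rintro rfl
    exact (c.memD.1 hQ).2.1 pi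
  exact hst (hs.eq_of_two ht hne ps qs pt qt)

end Cfg

lemma three_cases {s : Finset Pt} (hs : s.card = 3) {a b c d : Pt} (ha : a ∈ s) (hb : b ∈ s)
    (hc : c ∈ s) (hd : d ∈ s) (ab : a ≠ b) (ac : a ≠ c) (bc : b ≠ c) :
    d = a ∨ d = b ∨ d = c := by
  classical
  have hsub : ({a, b, c} : Finset Pt) ⊆ s := by
    intro x hx
    simp only [Finset.mem_insert, Finset.mem_singleton] at hx
    rcases hx with rfl | rfl | rfl <;> assumption
  have h3 := Finset.card_eq_three.2 ⟨a, b, c, ab, ac, bc, rfl⟩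
  have := Finset.eq_of_subset_of_card_le hsub (by omega)
  rw [← this] at hd
  simpa using hd

lemma Cfg.lemE {X : Finset Pt} {l : Set Pt} {D : Finset Pt} {i j k : Set Pt} {Ci Cj Ck C4 : Pt}
    {u v w : Set Pt} {T R : Pt} (c : Cfg X l D i j k Ci Cj Ck C4 u v w T R)
    (hv : ¬ Hit X j i k v) (hw : ¬ Hit X k i j w) :
    Cj ∈ w ∧ ∃ a x, IsLine a ∧ T ∈ a ∧ Ck ∈ a ∧ x ∈ a ∧ x ∈ X ∧ x ∈ j ∧ x ∉ i ∧ x ∉ k ∧ x ∉ u ∧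
      x ≠ Cj := by
  classical
  have cj' := c.sij
  have ck' := c.sjk.sij
  have uj : Hit X j i k u := cj'.one_miss c.mv c.mu c.uv.symm hv
  have wj : Hit X j i k w := cj'.one_miss c.mv c.mw c.vw hv
  have uk : Hit X k i j u := ck'.one_miss c.mw c.mu c.uw.symm hw
  have vk : Hit X k i j v := ck'.one_miss c.mw c.mv c.vw.symm hw
  have hu3 := c.mx3 c.mu uj uk
  have g3 := G_rm c.hG c.mxi
  have g2 := G_rm g3 hu3
  have offD : ∀ m, (m = i ∨ m = j ∨ m = k) → u ≠ m := by
    rintro m hm rfl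
    have := c.memD.1 c.c4.1
    have := c.c4.2.2.1
    rcases hm with rfl | rfl | rfl <;> tauto
  have zj : Mx 2 (rm (rm X i) u) j :=
    mx_rm g3 hu3 (mx_rm c.hG c.mxi c.mxj c.ij) (offD j (by tauto))
  have zk : Mx 2 (rm (rm X i) u) k :=
    mx_rm g3 hu3 (mx_rm c.hG c.mxi c.mxk c.ik) (offD k (by tauto))
  obtain ⟨V, hV, Vj, Vk⟩ := mx_common g2 zj zk
  obtain ⟨F, hF⟩ := g2.2 V hV
  have hTD := c.memD.1 c.hT.1
  have hTZ : T ∈ rm (rm X i) u := mem_rm.2 ⟨mem_rm.2 ⟨hTD.1, hTD.2.1⟩, c.hT.2.2.2.2⟩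
  obtain ⟨a, ha, Ta⟩ := hF.2.2.2 T hTZ (by rintro rfl; exact hTD.2.2.1 Vj)
  have haL := hF.2.1 a ha
  have hit : ∀ m, Mx 2 (rm (rm X i) u) m → V ∈ m →
      ∃ x ∈ rm (rm X i) u, x ∈ m ∧ x ≠ V ∧ x ∈ a := by
    intro m hm hVm
    obtain ⟨x, hx, hxa⟩ := exact_hit hF.2.1 hm.1 (hF.notin hVm)
      (T := (on (rm (rm X i) u) m).erase V) (m := 2)
      (fun B hB => (mem_on.1 (Finset.mem_of_mem_erase hB)).2)
      (fun B hB => hF.2.2.2 B (mem_on.1 (Finset.mem_of_mem_erase hB)).1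
        (Finset.ne_of_mem_erase hB)) hF.1
      (by rw [Finset.card_erase_of_mem (mem_on.2 ⟨hV, hVm⟩), hm.2]) ha
    have := mem_on.1 (Finset.mem_of_mem_erase hx)
    exact ⟨x, this.1, this.2, Finset.ne_of_mem_erase hx, hxa⟩
  obtain ⟨x, hxZ, xj, xV, xa⟩ := hit j zj Vj
  obtain ⟨y, hyZ, yk, yV, ya⟩ := hit k zk Vk
  have hx1 : x ∈ X ∧ x ∉ i ∧ x ∉ u := by
    simp only [mem_rm] at hxZ
    tauto
  have xk : x ∉ k := fun xk => c.jk (c.mxj.1.eq_of_two c.mxk.1 xV xj Vj xk Vk)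
  -- membership in `Z`
  have Cku : Ck ∉ u := fun hh =>
    ck'.off_i c.mu.1 c.hl c.ul c.c4.1 c.c4.2.2.1 c.c4.2.1 c.ck.2.1 hh c.ck.2.2.1
  have Cju : Cj ∉ u := fun hh =>
    cj'.off_i c.mu.1 c.hl c.ul c.c4.1 c.c4.2.2.1 c.c4.2.1 c.cj.2.1 hh c.cj.2.2.1
  have CkZ : Ck ∈ rm (rm X i) u := mem_rm.2 ⟨mem_rm.2 ⟨c.ck.1, c.ck.2.2.2.1⟩, Cku⟩
  have CjZ : Cj ∈ rm (rm X i) u := mem_rm.2 ⟨mem_rm.2 ⟨c.cj.1, c.cj.2.2.2.1⟩, Cju⟩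
  obtain ⟨g, g1, gk, gi, gj, gv⟩ := vk
  have gu : g ∉ u := fun hh =>
    ck'.off_i c.mu.1 c.mv.1 c.uv c.c4.1 c.c4.2.2.1 c.c4.2.2.2.1 gk hh gv
  have gZ : g ∈ rm (rm X i) u := mem_rm.2 ⟨mem_rm.2 ⟨g1, gi⟩, gu⟩
  have hyC : y = Ck := by
    rcases three_cases zk.2 (mem_on.2 ⟨hV, Vk⟩) (mem_on.2 ⟨CkZ, c.ck.2.1⟩) (mem_on.2 ⟨gZ, gk⟩)
      (mem_on.2 ⟨hyZ, yk⟩) (by rintro rfl; exact c.ck.2.2.2.2 Vj) (by rintro rfl; exact gj Vj)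
      (by
        intro e
        rw [← e] at gv
        exact ck'.off_i c.mv.1 c.hl c.vl c.c4.1 c.c4.2.2.2.1 c.c4.2.1 c.ck.2.1 gv c.ck.2.2.1)
      with e | e | e
    · exact absurd e yV
    · exact e
    · exfalso
      have hne : y ≠ T := by rintro rfl; exact hTD.2.2.2 yk
      have : a = v := haL.eq_of_two c.mv.1 hne ya Ta (e ▸ gv) c.hT.2.1
      subst this
      exact hv ⟨x, hx1.1, xj, hx1.2.1, xk, xa⟩
  rw [hyC] at ya
  have xCj : x ≠ Cj := by
    rintro rfl
    have hne : x ≠ Ck := by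
      rintro rfl
      exact xk c.ck.2.1
    have : a = l := haL.eq_of_two c.hl hne xa ya c.cj.2.2.1 c.ck.2.2.1
    subst this
    exact c.hT.2.2.2.1 Ta
  obtain ⟨h, h1, hj, hi, hk, hhw⟩ := wj
  have hhu : h ∉ u := fun hh =>
    cj'.off_i c.mu.1 c.mw.1 c.uw c.hR.1 c.hR.2.1 c.hR.2.2.1 hj hh hhw
  have hZ : h ∈ rm (rm X i) u := mem_rm.2 ⟨mem_rm.2 ⟨h1, hi⟩, hhu⟩
  have hCj : Cj = h := by
    by_contra hne
    rcases three_cases zj.2 (mem_on.2 ⟨hV, Vj⟩) (mem_on.2 ⟨CjZ, c.cj.2.1⟩) (mem_on.2 ⟨hZ, hj⟩)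
      (mem_on.2 ⟨hxZ, xj⟩) (by rintro rfl; exact c.cj.2.2.2.2 Vk) (by rintro rfl; exact hk Vk)
      hne with e | e | e
    · exact xV e
    · exact xCj e
    · have hne : x ≠ T := by rintro rfl; exact hTD.2.2.1 xj
      have : a = w := haL.eq_of_two c.mw.1 hne xa Ta (e ▸ hhw) c.hT.2.2.1
      subst this
      exact hw ⟨Ck, c.ck.1, c.ck.2.1, c.ck.2.2.2.1, c.ck.2.2.2.2, ya⟩
  exact ⟨hCj ▸ hhw, a, x, haL, Ta, ya, xa, hx1.1, xj, hx1.2.1, xk, hx1.2.2, xCj⟩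

lemma Cfg.fin {X : Finset Pt} {l : Set Pt} {D : Finset Pt} {i j k : Set Pt} {Ci Cj Ck C4 : Pt}
    {u v w : Set Pt} {T R : Pt} (c : Cfg X l D i j k Ci Cj Ck C4 u v w T R)
    (hv : ¬ Hit X j i k v) (hw : ¬ Hit X k i j w) : False := by
  have cj' := c.sij
  obtain ⟨hCj, a, x, ha, Ta, Ca, xa, x1, x2, x3, x4, x5, x6⟩ := c.lemE hv hw
  have ij_ne : Ci ≠ Cj := by
    rintro e
    exact c.ci.2.2.2.1 (e ▸ c.cj.2.1)
  have ik_ne : Ci ≠ Ck := by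
    rintro e
    exact c.ci.2.2.2.2 (e ▸ c.ck.2.1)
  have hCi : Ci ∉ w := fun hCi =>
    c.wl (c.mw.1.eq_of_two c.hl ij_ne hCi hCj c.ci.2.2.1 c.cj.2.2.1)
  have card3 : ∀ {i j k : Set Pt} {Ci Cj Ck : Pt}, Cfg X l D i j k Ci Cj Ck C4 u v w T R →
      (on (rm (rm X j) k) i).card = 3 := by
    intro i j k Ci Cj Ck c
    exact (mx_rm (G_rm c.hG c.mxj) (mx_rm c.hG c.mxj c.mxk c.jk) (mx_rm c.hG c.mxj c.mxi c.ij.symm)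
      c.ik.symm).2
  have memo : ∀ {i j k : Set Pt} {P : Pt}, P ∈ X → P ∈ i → P ∉ j → P ∉ k →
      P ∈ on (rm (rm X j) k) i := by
    intro i j k P a b c d
    simp only [mem_on, mem_rm]
    tauto
  by_cases wi : Hit X i j k w
  · by_cases vi : Hit X i j k v
    · by_cases ui : Hit X i j k u
      · obtain ⟨P, p1, p2, p3, p4, p5⟩ := ui
        obtain ⟨Q, q1, q2, q3, q4, q5⟩ := vi
        obtain ⟨S, s1, s2, s3, s4, s5⟩ := wi
        rcases three_cases (card3 c) (memo p1 p2 p3 p4) (memo q1 q2 q3 q4) (memo s1 s2 s3 s4)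
          (memo c.ci.1 c.ci.2.1 c.ci.2.2.2.1 c.ci.2.2.2.2)
          (by
            rintro rfl
            exact c.off_i c.mu.1 c.mv.1 c.uv c.c4.1 c.c4.2.2.1 c.c4.2.2.2.1 p2 p5 q5)
          (by
            rintro rfl
            exact c.off_i c.mu.1 c.mw.1 c.uw c.hR.1 c.hR.2.1 c.hR.2.2.1 p2 p5 s5)
          (by
            rintro rfl
            exact c.off_i c.mv.1 c.mw.1 c.vw c.hT.1 c.hT.2.1 c.hT.2.2.1 q2 q5 s5)
          with e | e | e
        · rw [← e] at p5
          exact c.off_i c.mu.1 c.hl c.ul c.c4.1 c.c4.2.2.1 c.c4.2.1 c.ci.2.1 p5 c.ci.2.2.1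
        · rw [← e] at q5
          exact c.off_i c.mv.1 c.hl c.vl c.c4.1 c.c4.2.2.2.1 c.c4.2.1 c.ci.2.1 q5 c.ci.2.2.1
        · exact hCi (e ▸ s5)
      · exact hCi (c.suv.sij.lemE ui (fun hh => hw hh.symm)).1
    · exact hCi (c.sij.lemE vi (fun hh => hw hh.symm)).1
  · obtain ⟨-, a', x', ha', Ta', Ca', xa', y1, y2, y3, y4, y5, y6⟩ :=
      c.sij.sjk.sij.lemE (fun hh => hv hh.symm) (fun hh => wi hh.symm)
    obtain ⟨P, p1, p2, p3, p4, p5⟩ := cj'.one_miss c.mv c.mu c.uv.symm hv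
    have Cju : Cj ∉ u := fun hh =>
      cj'.off_i c.mu.1 c.hl c.ul c.c4.1 c.c4.2.2.1 c.c4.2.1 c.cj.2.1 hh c.cj.2.2.1
    have hxx : x' = x := by
      rcases three_cases (card3 cj') (memo p1 p2 p3 p4)
        (memo c.cj.1 c.cj.2.1 c.cj.2.2.2.1 c.cj.2.2.2.2) (memo x1 x2 x3 x4)
        (memo y1 y2 y4 y3) (by rintro rfl; exact Cju p5) (by rintro rfl; exact x5 p5)
        x6.symm with e | e | e
      · exact absurd (e ▸ p5) y5
      · exact absurd e y6
      · exact e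
    have hne : x ≠ T := by
      rintro rfl
      exact (c.memD.1 c.hT.1).2.2.1 x2
    have : a = a' := ha.eq_of_two ha' hne xa Ta (hxx ▸ xa') Ta'
    subst this
    have : a = l := ha.eq_of_two c.hl ik_ne Ca' Ca c.ci.2.2.1 c.ck.2.2.1
    subst this
    exact c.hT.2.2.2.1 Ta

lemma Cfg.fin2 {X : Finset Pt} {l : Set Pt} {D : Finset Pt} {i j k : Set Pt} {Ci Cj Ck C4 : Pt}
    {u v w : Set Pt} {T R : Pt} (c : Cfg X l D i j k Ci Cj Ck C4 u v w T R)
    (hw : ¬ Hit X k i j w) (hv : ¬ (Hit X i j k v ∧ Hit X j i k v ∧ Hit X k i j v)) : False := by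
  have vk := c.sjk.sij.one_miss c.mw c.mv c.vw.symm hw
  by_cases vj : Hit X j i k v
  · by_cases vi : Hit X i j k v
    · exact hv ⟨vi, vj, vk⟩
    · exact c.sij.fin vi (fun hh => hw hh.symm)
  · exact c.fin vj hw

lemma E_four (hC : CC 0) (h3 : ∀ Y, G 4 Y → Three 4 Y) (X : Finset Pt) (l : Set Pt) (h : G 4 X)
    (hl : IsLine l) (hc : (on X l).card = 4) : TA 4 X l ∨ TB 4 X l := by
  classical
  by_contra hn
  push Not at hn
  obtain ⟨hA, hB⟩ := hn
  obtain ⟨i, j, k, mxi, mxj, mxk, ij, ik, jk⟩ := h3 X h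
  obtain ⟨Ci, i1, i2, i3⟩ := hit_of_nTA hA mxi
  obtain ⟨Cj, j1, j2, j3⟩ := hit_of_nTA hA mxj
  obtain ⟨Ck, k1, k2, k3⟩ := hit_of_nTA hA mxk
  have nB : ∀ M M' P, Mx 4 X M → Mx 4 X M' → M ≠ M' → P ∈ X → P ∈ M → P ∈ l → P ∉ M' :=
    fun M M' P a b c d e f g => hB ⟨M, M', a, b, c, P, d, e, g, f⟩
  have r1 := mx_rm h mxi mxj ij
  have r2 := mx_rm h mxi mxk ik
  have g1 := G_rm h mxi
  have r3 := mx_rm g1 r1 r2 jk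
  have g2 := G_rm g1 r1
  have g3 := G_rm g2 r3
  obtain ⟨D, hD⟩ : ∃ D, D = rm (rm (rm X i) j) k := ⟨_, rfl⟩
  rw [← hD] at g3
  have memD : ∀ P, P ∈ D ↔ P ∈ X ∧ P ∉ i ∧ P ∉ j ∧ P ∉ k := by
    intro P
    rw [hD]
    simp only [mem_rm]
    tauto
  have cD : (on D l).card = 1 := by
    have e1 := on_rm_card mxi.1 hl (mx_ne_of_card mxi hc) i1 i2 i3
    have e2 := on_rm_card (Y := rm X i) mxj.1 hl (mx_ne_of_card mxj hc)
      (mem_rm.2 ⟨j1, nB j i Cj mxj mxi ij.symm j1 j2 j3⟩) j2 j3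
    have e3 := on_rm_card (Y := rm (rm X i) j) mxk.1 hl (mx_ne_of_card mxk hc)
      (mem_rm.2 ⟨mem_rm.2 ⟨k1, nB k i Ck mxk mxi ik.symm k1 k2 k3⟩,
        nB k j Ck mxk mxj jk.symm k1 k2 k3⟩) k2 k3
    rw [hD]
    omega
  obtain ⟨C4, hC4⟩ := Finset.card_eq_one.1 cD
  have hC4' : C4 ∈ D ∧ C4 ∈ l := mem_on.1 (by rw [hC4]; simp)
  have uniq : ∀ P ∈ D, P ∈ l → P = C4 := by
    intro P hP hPl
    have : P ∈ on D l := mem_on.2 ⟨hP, hPl⟩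
    rw [hC4] at this
    simpa using this
  -- the side configuration
  have sides : ∃ u v w, Mx 1 D u ∧ Mx 1 D v ∧ Mx 1 D w ∧ u ≠ v ∧ u ≠ w ∧ v ≠ w ∧ C4 ∈ u ∧
      C4 ∈ v ∧ C4 ∉ w := by
    obtain ⟨p, q, r, hp, hq, hr, pq, pr, qr⟩ := CG_one D g3
    have hD3 : D.card = 3 := by rw [g3.1.1]; decide
    have comb : ∀ s t, Mx 1 D s → Mx 1 D t → s ≠ t → C4 ∉ s → C4 ∉ t → False := by
      intro s t hs ht hst cs ct
      have hsub : ∀ s, Mx 1 D s → C4 ∉ s → on D s = D.erase C4 := by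
        intro s hs cs
        apply Finset.eq_of_subset_of_card_le
        · intro x hx
          have := mem_on.1 hx
          exact Finset.mem_erase.2 ⟨by rintro rfl; exact cs this.2, this.1⟩
        · rw [Finset.card_erase_of_mem hC4'.1, hD3, hs.2]
      have e : on D s = on D t := by rw [hsub s hs cs, hsub t ht ct]
      obtain ⟨A, hA, B, hB, hAB⟩ := Finset.one_lt_card.1 (show 1 < (on D s).card by rw [hs.2]; omega)
      have hA' := hA
      have hB' := hB
      rw [e] at hA' hB'
      exact hst (hs.1.eq_of_two ht.1 hAB (mem_on.1 hA).2 (mem_on.1 hB).2 (mem_on.1 hA').2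
        (mem_on.1 hB').2)
    by_cases cp : C4 ∈ p
    · by_cases cq : C4 ∈ q
      · exact ⟨p, q, r, hp, hq, hr, pq, pr, qr, cp, cq,
          fun cr => no3 g3 hp hq hr pq pr qr cp cq cr⟩
      · by_cases cr : C4 ∈ r
        · exact ⟨p, r, q, hp, hr, hq, pr, pq, qr.symm, cp, cr, cq⟩
        · exact (comb q r hq hr qr cq cr).elim
    · by_cases cq : C4 ∈ q
      · by_cases cr : C4 ∈ r
        · exact ⟨q, r, p, hq, hr, hp, qr, pq.symm, pr.symm, cq, cr, cp⟩
        · exact (comb p r hp hr pr cp cr).elim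
      · exact (comb p q hp hq pq cp cq).elim
  obtain ⟨u, v, w, mu, mv, mw, uv, uw, vw, cu, cv, cw⟩ := sides
  obtain ⟨T, t1, t2, t3⟩ := mx_common g3 mv mw
  obtain ⟨R, s1, s2, s3⟩ := mx_common g3 mu mw
  have c : Cfg X l D i j k Ci Cj Ck C4 u v w T R :=
    { hC := hC, hG := h, hl := hl, mxi := mxi, mxj := mxj, mxk := mxk, ij := ij, ik := ik, jk := jk
      ci := ⟨i1, i2, i3, nB _ _ _ mxi mxj ij i1 i2 i3, nB _ _ _ mxi mxk ik i1 i2 i3⟩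
      cj := ⟨j1, j2, j3, nB _ _ _ mxj mxi ij.symm j1 j2 j3, nB _ _ _ mxj mxk jk j1 j2 j3⟩
      ck := ⟨k1, k2, k3, nB _ _ _ mxk mxi ik.symm k1 k2 k3, nB _ _ _ mxk mxj jk.symm k1 k2 k3⟩
      hD := hD, mu := mu, mv := mv, mw := mw, uv := uv, uw := uw, vw := vw
      c4 := ⟨hC4'.1, hC4'.2, cu, cv, cw⟩
      hT := ⟨t1, t2, t3, fun e => cw (uniq T t1 e ▸ t3), fun e => no3 g3 mu mv mw uv uw vw e t2 t3⟩
      hR := ⟨s1, s2, s3, fun e => cw (uniq R s1 e ▸ s3),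
        fun e => no3 g3 mu mv mw uv uw vw s2 e s3⟩ }
  -- `w` misses one of the three lines
  have w_not : ¬ (Hit X i j k w ∧ Hit X j i k w ∧ Hit X k i j w) := by
    rintro ⟨a1, a2, a3⟩
    have hw4 := c.mx4 mw a1 a2 a3
    obtain ⟨P, p1, p2, p3⟩ := hit_of_nTA hA hw4
    have tD := (memD T).1 t1
    have ni : P ∉ i := nB w i P hw4 mxi (by rintro rfl; exact tD.2.1 t3) p1 p2 p3
    have nj : P ∉ j := nB w j P hw4 mxj (by rintro rfl; exact tD.2.2.1 t3) p1 p2 p3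
    have nk : P ∉ k := nB w k P hw4 mxk (by rintro rfl; exact tD.2.2.2 t3) p1 p2 p3
    exact cw (uniq P ((memD P).2 ⟨p1, ni, nj, nk⟩) p3 ▸ p2)
  have uv_not : ¬ (Hit X i j k u ∧ Hit X j i k u ∧ Hit X k i j u) ∨
      ¬ (Hit X i j k v ∧ Hit X j i k v ∧ Hit X k i j v) := by
    by_contra hno
    push Not at hno
    obtain ⟨⟨a1, a2, a3⟩, b1, b2, b3⟩ := hno
    exact hB ⟨u, v, c.mx4 mu a1 a2 a3, c.mx4 mv b1 b2 b3, uv, C4, ((memD C4).1 hC4'.1).1, cu, cv,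
      hC4'.2⟩
  have main : ∀ {u v : Set Pt} {T R : Pt}, Cfg X l D i j k Ci Cj Ck C4 u v w T R →
      ¬ (Hit X i j k v ∧ Hit X j i k v ∧ Hit X k i j v) → False := by
    intro u v T R c hv
    by_cases wk : Hit X k i j w
    · by_cases wj : Hit X j i k w
      · have wi : ¬ Hit X i j k w := fun wi => w_not ⟨wi, wj, wk⟩
        refine c.sij.sjk.fin2 wi ?_
        rintro ⟨a1, a2, a3⟩
        exact hv ⟨a3.symm.symm, a1.symm, a2.symm⟩
      · refine c.sjk.fin2 wj ?_
        rintro ⟨a1, a2, a3⟩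
        exact hv ⟨a1.symm, a3, a2⟩
    · exact c.fin2 wk hv
  rcases uv_not with hu | hv
  · exact main c.suv hu
  · exact main c hv

lemma E_all {N : ℕ} (hN : GMC N) (d : ℕ) : d + 4 ≤ N → ∀ (X : Finset Pt) (l : Set Pt),
    G (d + 4) X → IsLine l → (on X l).card = d + 4 → TA (d + 4) X l ∨ TB (d + 4) X l := by
  induction d with
  | zero =>
    intro hd
    exact E_four (claimC hN (by omega)) (fun Y hY => CG hN (n := 3) (by omega) hY)
  | succ d ih =>
    intro hd
    exact E_step (d := d + 2) (claimC hN (by omega))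
      (fun Y hY => CG hN (n := d + 4) (by omega) hY) (by omega) (ih (by omega))

lemma final {n : ℕ} (hN : GMC n) (hn1 : 1 ≤ n) (hn3 : n ≠ 3) {X : Finset Pt} (h : G n X)
    {l : Set Pt} (hl : IsLine l) (hc : (on X l).card = n) :
    ∃ S : Finset Pt, (∀ A, A ∈ S ↔ A ∈ X ∧ UsesC n X l A) ∧
      (S.card = n.choose 2 ∨ S.card = (n - 1).choose 2) := by
  obtain rfl | hn2 : n = 1 ∨ 2 ≤ n := by omega
  · refine ⟨∅, ?_, Or.inl (by decide)⟩
    intro A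
    constructor
    · intro hA
      simp at hA
    · rintro ⟨hA, hU⟩
      exact absurd hU (count_one h hc A hA)
  · have hT : TA n X l ∨ TB n X l := by
      obtain rfl | hn4 : n = 2 ∨ 4 ≤ n := by omega
      · exact deg_two (CG hN (n := 1) (by omega) h) hc
      · obtain ⟨d, rfl⟩ : ∃ d, n = d + 4 := ⟨n - 4, by omega⟩
        exact E_all hN d le_rfl X l h hl hc
    obtain ⟨m, rfl⟩ : ∃ m, n = m + 2 := ⟨n - 2, by omega⟩
    rcases hT with hT | hT
    · obtain ⟨S, h1, h2⟩ := countA (n := m + 1) h hl hc hT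
      exact ⟨S, h1, Or.inl h2⟩
    · obtain ⟨S, h1, h2⟩ := countB h hl hc hT
      exact ⟨S, h1, Or.inr h2⟩

end GCN

/-- Assuming GM up to degree `n`, for a `GC_n` set `X` with `n ≥ 1`, `n ≠ 3`,
and an `n`-node line `ℓ`, `|X_ℓ| = (n choose 2)` or `|X_ℓ| = (n-1 choose 2)`. -/
theorem stmt_4 (n : ℕ) (hGM : ∀ m ≤ n, GM m) (hn1 : 1 ≤ n) (hn3 : n ≠ 3)
    (X : Finset (ℝ × ℝ)) (hX : IsGC n X)
    (ℓ : Poly2) (hℓ : IsKNodeLine X ℓ n) :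
    (usesSet n X ℓ).card = n.choose 2 ∨ (usesSet n X ℓ).card = (n - 1).choose 2 := by
  have hG := GCN.G_of_IsGC hX
  have hc := hℓ.2
  rw [GCN.nodesOn_eq] at hc
  obtain ⟨S, h1, h2⟩ := GCN.final (GCN.GMC_of hGM) hn1 hn3 hG (GCN.isLine_zeroSet hℓ.1) hc
  rw [GCN.card_usesSet hG hℓ.1 S h1]
  exact h2
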